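/- Let (P, α) be a maximal (p,q)-pair of rank 3. If p > 3, then |P| ≤ p^5. -/

import Mathlib

/-- The minimal number of generators of a group. -/
noncomputable def dG (G : Type*) [Group G] : ℕ :=
  sInf {n | ∃ S : Finset G, S.card = n ∧ Subgroup.closure (S : Set G) = ⊤}

/-- A maximal `(p,q)`-pair of rank `d`. -/
def IsMaximalPair (p q d : ℕ) (P : Type*) [Group P] (α : P ≃* P) : Prop :=
  p.Prime ∧ q.Prime ∧ Finite P ∧ IsPGroup p P ∧ orderOf α = q ∧ q ∣ p - 1 ∧
  dG P = d ∧ (∀ H : Subgroup P, dG H ≤ d) ∧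
  (∃ k : ℤ, ¬ ((p : ℤ) ∣ k - 1) ∧ ∀ x : P, α x * (x ^ k)⁻¹ ∈ frattini P) ∧
  (∀ H : Subgroup P, H ≠ ⊤ → dG H = d →
    H.map α.toMonoidHom ≠ H ∨
      ¬ ∃ k : ℤ, ¬ ((p : ℤ) ∣ k - 1) ∧
        ∀ x : H, α (x : P) * ((x : P) ^ k)⁻¹ ∈ (frattini H).map H.subtype)


namespace MP

open scoped commutatorElement

section calculations
variable {G : Type*} [Group G]

lemma cl2_pow {x c η : G} (h : c * x = x * c * η) (hx : Commute η x) (hc : Commute η c) (n : ℕ) :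
    (x * c) ^ n = x ^ n * c ^ n * η ^ (n.choose 2) := by
  have hn : ∀ n : ℕ, c ^ n * x = x * c ^ n * η ^ n := by
    intro n
    induction n with
    | zero => simp
    | succ n ih =>
      calc c ^ (n+1) * x = c ^ n * (c * x) := by rw [pow_succ]; group
        _ = (c ^ n * x) * c * η := by rw [h]; group
        _ = x * c ^ n * (η ^ n * c) * η := by rw [ih]; group
        _ = x * c ^ (n+1) * η ^ (n+1) := by rw [(hc.pow_left n).eq]; group
  induction n with
  | zero => simp
  | succ n ih =>
    calc (x * c) ^ (n+1) = x ^ n * c ^ n * (η ^ (n.choose 2) * x) * c := by rw [pow_succ, ih]; group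
      _ = x ^ n * (c ^ n * x) * (η ^ (n.choose 2) * c) := by rw [(hx.pow_left _).eq]; group
      _ = x ^ (n+1) * c ^ n * (η ^ n * c) * η ^ (n.choose 2) := by
          rw [hn, (hc.pow_left _).eq, pow_succ]; group
      _ = x ^ (n+1) * c ^ (n+1) * η ^ (n + n.choose 2) := by
          rw [(hc.pow_left _).eq, pow_succ, pow_add]; group
      _ = _ := by rw [Nat.choose_succ_succ' n 1, Nat.choose_one_right]

lemma cl3_pow {x y c ζ η : G} (h1 : x * y = y * x * c) (h2 : c * y = y * c * ζ)
    (h3 : c * x = x * c * η) (hζ : ζ ∈ Subgroup.center G) (hη : η ∈ Subgroup.center G) (n : ℕ) :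
    (y * x) ^ n = y ^ n * x ^ n * c ^ (n.choose 2) * ζ ^ (n.choose 3) *
      η ^ (2 * n.choose 3 + n.choose 2) := by
  have cζ : ∀ (m : ℕ) (g : G), ζ ^ m * g = g * ζ ^ m := fun m g =>
    ((Subgroup.mem_center_iff.1 (Subgroup.pow_mem _ hζ m)) g).symm
  have cη : ∀ (m : ℕ) (g : G), η ^ m * g = g * η ^ m := fun m g =>
    ((Subgroup.mem_center_iff.1 (Subgroup.pow_mem _ hη m)) g).symm
  have cη1 : ∀ g : G, Commute η g := fun g => ((Subgroup.mem_center_iff.1 hη) g).symm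
  have cζ1 : ∀ g : G, Commute ζ g := fun g => ((Subgroup.mem_center_iff.1 hζ) g).symm
  have hcy : ∀ n : ℕ, c ^ n * y = y * c ^ n * ζ ^ n := by
    intro n
    have : c ^ n * y = y * (y⁻¹ * c * y) ^ n := by
      have := conj_pow (a := y⁻¹) (b := c) (i := n)
      rw [inv_inv] at this
      rw [this]; group
    rw [this, mul_assoc y⁻¹, h2]
    have : y⁻¹ * (y * c * ζ) = c * ζ := by group
    rw [this, (cζ1 c).symm.mul_pow, mul_assoc]
  have hcx : ∀ n : ℕ, c ^ n * x = x * c ^ n * η ^ n := by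
    intro n
    have : c ^ n * x = x * (x⁻¹ * c * x) ^ n := by
      have := conj_pow (a := x⁻¹) (b := c) (i := n)
      rw [inv_inv] at this
      rw [this]; group
    rw [this, mul_assoc x⁻¹, h3]
    have : x⁻¹ * (x * c * η) = c * η := by group
    rw [this, (cη1 c).symm.mul_pow, mul_assoc]
  have hxy : ∀ n : ℕ, x ^ n * y = y * (x ^ n * c ^ n * η ^ (n.choose 2)) := by
    intro n
    have : x ^ n * y = y * (y⁻¹ * x * y) ^ n := by
      have := conj_pow (a := y⁻¹) (b := x) (i := n)
      rw [inv_inv] at this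
      rw [this]; group
    rw [this, mul_assoc y⁻¹, h1]
    have : y⁻¹ * (y * x * c) = x * c := by group
    rw [this, cl2_pow h3 (cη1 x) (cη1 c)]
  induction n with
  | zero => simp
  | succ n ih =>
    set m := n.choose 2 with hm
    set a := n.choose 3 with ha
    have e1 : (n+1).choose 2 = n + m := by
      rw [Nat.choose_succ_succ' n 1, Nat.choose_one_right]
    have e2 : (n+1).choose 3 = m + a := by
      rw [Nat.choose_succ_succ' n 2]
    rw [pow_succ, ih, e1, e2]
    calc y ^ n * x ^ n * c ^ m * ζ ^ a * η ^ (2 * a + m) * (y * x)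
        = y ^ n * x ^ n * c ^ m * (ζ ^ a * (η ^ (2 * a + m) * (y * x))) := by group
      _ = y ^ n * x ^ n * c ^ m * (y * x) * (η ^ (2 * a + m) * ζ ^ a) := by
          rw [cη, cζ]; group
      _ = y ^ n * x ^ n * (c ^ m * y) * x * (η ^ (2 * a + m) * ζ ^ a) := by group
      _ = y ^ n * (x ^ n * y) * c ^ m * (ζ ^ m * x) * (η ^ (2 * a + m) * ζ ^ a) := by
          rw [hcy]; group
      _ = y ^ n * y * x ^ n * c ^ n * (η ^ m * (c ^ m * x)) * ζ ^ m * (η ^ (2 * a + m) * ζ ^ a) := by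
          rw [hxy, cζ, ← hm]; group
      _ = y ^ (n+1) * x ^ n * c ^ n * (c ^ m * x) * η ^ m * ζ ^ m * (η ^ (2 * a + m) * ζ ^ a) := by
          rw [cη]; group
      _ = y ^ (n+1) * x ^ n * (c ^ (n + m) * x) * η ^ m * ζ ^ m * (η ^ (2 * a + m) * ζ ^ a) := by
          rw [pow_add]; group
      _ = y ^ (n+1) * x ^ (n+1) * c ^ (n+m) * (η ^ (n+m) * η ^ m * (ζ ^ m * η ^ (2 * a + m)) * ζ ^ a) := by
          rw [hcx]; group
      _ = y ^ (n+1) * x ^ (n+1) * c ^ (n+m) * (η ^ (n+m) * η ^ m * η ^ (2 * a + m) * (ζ ^ m * ζ ^ a)) := by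
          rw [cζ m (η ^ (2 * a + m))]; group
      _ = y ^ (n+1) * x ^ (n+1) * c ^ (n+m) * (η ^ (2 * (m+a) + (n+m)) * ζ ^ (m + a)) := by
          rw [← pow_add, ← pow_add, ← pow_add]
          congr 3
          ring
      _ = _ := by rw [cη]; group

lemma comm_zpow {a b : G} (h : ⁅a, b⁆ ∈ Subgroup.center G) (i j : ℤ) :
    ⁅a ^ i, b ^ j⁆ = ⁅a, b⁆ ^ (i * j) := by
  have key : ∀ (a b : G), ⁅a, b⁆ ∈ Subgroup.center G → ∀ j : ℤ, ⁅a, b ^ j⁆ = ⁅a, b⁆ ^ j := by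
    intro a b h j
    have hc : Commute ⁅a, b⁆ b := ((Subgroup.mem_center_iff.1 h) b).symm
    have : a * b ^ j * a⁻¹ = (⁅a, b⁆ * b) ^ j := by
      rw [← conj_zpow, commutatorElement_def]; congr 1; group
    rw [commutatorElement_def, this, hc.mul_zpow]; group
  have key2 : ∀ i : ℤ, ⁅a ^ i, b⁆ = ⁅a, b⁆ ^ i := by
    intro i
    have h' : ⁅b, a⁆ ∈ Subgroup.center G := by
      rw [← commutatorElement_inv]; exact Subgroup.inv_mem _ h
    rw [← commutatorElement_inv, key b a h', ← commutatorElement_inv a b, inv_zpow, inv_inv]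
  have h2 : ⁅a ^ i, b⁆ ∈ Subgroup.center G := by rw [key2]; exact Subgroup.zpow_mem _ h _
  rw [key _ _ h2, key2, zpow_mul]

lemma comm_eig {a b f g : G} (h : ⁅a, b⁆ ∈ Subgroup.center G) (i j : ℤ)
    (hfb : Commute f b) (hfg : Commute f g) (hag : Commute a g) :
    ⁅a ^ i * f, b ^ j * g⁆ = ⁅a, b⁆ ^ (i * j) := by
  rw [← comm_zpow h, commutatorElement_def, commutatorElement_def]
  have e1 : f * (b ^ j * g) = b ^ j * g * f := ((hfb.zpow_right j).mul_right hfg).eq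
  have e2 : a ^ i * g = g * a ^ i := (hag.zpow_left i).eq
  have e3 : g * (a ^ i)⁻¹ = (a ^ i)⁻¹ * g := ((hag.zpow_left i).inv_left).eq.symm
  calc a ^ i * f * (b ^ j * g) * (a ^ i * f)⁻¹ * (b ^ j * g)⁻¹
      = a ^ i * (f * (b ^ j * g)) * f⁻¹ * (a ^ i)⁻¹ * g⁻¹ * (b ^ j)⁻¹ := by group
    _ = a ^ i * b ^ j * (g * (a ^ i)⁻¹) * g⁻¹ * (b ^ j)⁻¹ := by rw [e1]; group
    _ = _ := by rw [e3]; group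

lemma comm_mul_left {a a' b : G} (h : ⁅a', b⁆ ∈ Subgroup.center G) :
    ⁅a * a', b⁆ = ⁅a, b⁆ * ⁅a', b⁆ := by
  have := Subgroup.mem_center_iff.1 h
  have e : ⁅a * a', b⁆ = a * ⁅a', b⁆ * a⁻¹ * ⁅a, b⁆ := by
    simp only [commutatorElement_def]; group
  rw [e, this a, mul_inv_cancel_right, this]

lemma dvd_choose2 {p : ℕ} (hp : p.Prime) (h3 : 3 < p) : p ∣ p.choose 2 :=
  hp.dvd_choose_self (by norm_num) (by omega)
lemma dvd_choose3 {p : ℕ} (hp : p.Prime) (h3 : 3 < p) : p ∣ p.choose 3 :=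
  hp.dvd_choose_self (by norm_num) (by omega)

lemma pow_dvd_one {p n : ℕ} {g : G} (h : g ^ p = 1) (hn : p ∣ n) : g ^ n = 1 := by
  obtain ⟨m, rfl⟩ := hn; rw [pow_mul, h, one_pow]

lemma pow_hom {p : ℕ} (hp : p.Prime) (h3 : 3 < p) (hc : ∀ g : G, g ^ p ∈ Subgroup.center G)
    (hn : ∀ a b g : G, ⁅⁅a, b⁆, g⁆ ∈ Subgroup.center G) :
    (∀ a b : G, ⁅a, b⁆ ^ p = 1) ∧ (∀ a b g : G, ⁅⁅a, b⁆, g⁆ ^ p = 1) ∧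
    (∀ a b : G, (a * b) ^ p = a ^ p * b ^ p) := by
  have hn2 : ∀ a b g : G, ⁅⁅a, b⁆, g⁆ ^ p = 1 := by
    intro a b g
    have := comm_zpow (hn a b g) 1 p
    simp only [zpow_one, one_mul, zpow_natCast] at this
    rw [← this, commutatorElement_eq_one_iff_mul_comm]
    exact Subgroup.mem_center_iff.1 (hc g) _
  have cc : ∀ a b g : G, ⁅a, b⁆ * g = g * ⁅a, b⁆ * ⁅⁅a, b⁆, g⁆ := by
    intro a b g
    have := Subgroup.mem_center_iff.1 (hn a b g) (g * ⁅a, b⁆)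
    rw [this, commutatorElement_def ⁅a, b⁆ g]; group
  have hn1 : ∀ a b : G, ⁅a, b⁆ ^ p = 1 := by
    intro a b
    -- b⁻¹... use a * ⁅a⁻¹, b⁆ = b * a * b⁻¹
    have key : ∀ a b : G, ⁅a⁻¹, b⁆ ^ p = 1 := by
      intro a b
      have e : a * ⁅a⁻¹, b⁆ = b * a * b⁻¹ := by rw [commutatorElement_def]; group
      have f := cl2_pow (cc a⁻¹ b a) ((Subgroup.mem_center_iff.1 (hn a⁻¹ b a) _).symm)
        ((Subgroup.mem_center_iff.1 (hn a⁻¹ b a) _).symm) p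
      rw [e, conj_pow, pow_dvd_one (hn2 _ _ _) (dvd_choose2 hp h3), mul_one,
        Subgroup.mem_center_iff.1 (hc a) b, mul_inv_cancel_right] at f
      exact (left_eq_mul.1 f)
    simpa using key a⁻¹ b
  refine ⟨hn1, hn2, ?_⟩
  intro y x
  have h1 : x * y = y * x * ⁅x⁻¹, y⁻¹⁆ := by rw [commutatorElement_def]; group
  have f := cl3_pow h1 (cc _ _ y) (cc _ _ x) (hn _ _ _) (hn _ _ _) p
  rw [f, pow_dvd_one (hn1 _ _) (dvd_choose2 hp h3), pow_dvd_one (hn2 _ _ _) (dvd_choose3 hp h3),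
    pow_dvd_one (hn2 _ _ _) (Dvd.dvd.add (Dvd.dvd.mul_left (dvd_choose3 hp h3) 2)
      (dvd_choose2 hp h3))]
  simp

end calculations
end MP


namespace MP
open scoped commutatorElement
section basics

lemma eigen_exists_lin {p : ℕ} [Fact p.Prime] {V : Type*} [AddCommGroup V] [Module (ZMod p) V]
    [Finite V] [Nontrivial V] (f : Module.End (ZMod p) V) (hfp : f ^ (p - 1) = 1) :
    ∃ v : V, v ≠ 0 ∧ ∃ m : ℕ, f v = m • v := by
  have hp : p.Prime := Fact.out
  have hdvd : minpoly (ZMod p) f ∣ (Polynomial.X ^ (p - 1) - 1) := by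
    apply minpoly.dvd
    simp [hfp]
  have hspl : (Polynomial.X ^ (p - 1) - 1 : Polynomial (ZMod p)).Splits := by
    have h2 : (Polynomial.X ^ p - Polynomial.X : Polynomial (ZMod p)).Splits := by
      have := Polynomial.splits_X_pow_nat_card_sub_X (K := ZMod p)
      simpa using this
    refine h2.of_dvd (FiniteField.X_pow_card_sub_X_ne_zero _ hp.one_lt) ⟨Polynomial.X, ?_⟩
    have : (Polynomial.X ^ p : Polynomial (ZMod p)) = Polynomial.X ^ (p - 1 + 1) := by
      congr 1; have := hp.one_lt; omega
    rw [this, pow_succ]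
    ring
  have hne : (Polynomial.X ^ (p - 1) - 1 : Polynomial (ZMod p)) ≠ 0 := by
    have := Polynomial.X_pow_sub_C_ne_zero (R := ZMod p) (n := p - 1)
      (by have := hp.one_lt; omega) 1
    simpa using this
  have hs := hspl.of_dvd hne hdvd
  have : Module.Finite (ZMod p) V := Module.Finite.of_finite
  have hfi : IsIntegral (ZMod p) f := Algebra.IsIntegral.isIntegral f
  obtain ⟨a, ha⟩ := hs.exists_eval_eq_zero (minpoly.degree_pos hfi).ne'
  obtain ⟨v, hv⟩ := (Module.End.hasEigenvalue_of_isRoot (f := f) (μ := a) ha).exists_hasEigenvector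
  refine ⟨v, hv.2, a.val, ?_⟩
  rw [hv.apply_eq_smul, ← Nat.cast_smul_eq_nsmul (ZMod p), ZMod.natCast_zmod_val]

lemma eigen_exists_add {p q : ℕ} (hp : p.Prime) (hq : q ∣ p - 1) {V : Type*} [AddCommGroup V]
    [Finite V] [Nontrivial V] (hW : ∀ w : V, p • w = 0) (β : V →+ V) (hβ : ∀ w, β^[q] w = w) :
    ∃ w : V, w ≠ 0 ∧ ∃ m : ℕ, β w = m • w := by
  have : Fact p.Prime := ⟨hp⟩
  let _ : Module (ZMod p) V := AddCommGroup.zmodModule (n := p) hW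
  have hfn : ∀ n : ℕ, ∀ x : V,
      ((β.toZModLinearMap p : Module.End (ZMod p) V) ^ n) x = β^[n] x := by
    intro n
    induction n with
    | zero => intro x; simp
    | succ n ih =>
      intro x
      rw [pow_succ', Module.End.mul_apply, ih, Function.iterate_succ_apply']; rfl
  obtain ⟨v, hv, m, hm⟩ := eigen_exists_lin (p := p)
    (β.toZModLinearMap p : Module.End (ZMod p) V) (by
    obtain ⟨r, hr⟩ := hq
    have : (β.toZModLinearMap p : Module.End (ZMod p) V) ^ q = 1 := by
      ext x; rw [hfn, hβ]; rfl
    rw [hr, pow_mul, this, one_pow])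
  exact ⟨v, hv, m, hm⟩

lemma eigen_exists {p q : ℕ} (hp : p.Prime) (hq : q ∣ p - 1) {W : Type*} [CommGroup W] [Finite W]
    [Nontrivial W] (hW : ∀ w : W, w ^ p = 1) (β : W →* W) (hβ : ∀ w, β^[q] w = w) :
    ∃ w : W, w ≠ 1 ∧ ∃ m : ℕ, β w = w ^ m := by
  obtain ⟨v, hv, m, hm⟩ := eigen_exists_add (V := Additive W) hp hq hW (MonoidHom.toAdditive β) hβ
  exact ⟨v.toMul, hv, m, hm⟩

variable {G : Type*} [Group G]

lemma card_lt {p : ℕ} (hp : p.Prime) [Finite G] (hG : IsPGroup p G) {A B : Subgroup G}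
    (h : A ≤ B) {u : G} (hu : u ∈ B) (hu' : u ∉ A) : p * Nat.card A ≤ Nat.card B := by
  have : Fact p.Prime := ⟨hp⟩
  have h1 : A.relIndex B * Nat.card A = Nat.card B := by
    have := (A.subgroupOf B).card_mul_index
    rw [mul_comm, Nat.card_congr (Subgroup.subgroupOfEquivOfLe h).toEquiv] at this
    exact this
  obtain ⟨n, hn⟩ := (hG.to_subgroup B).index (A.subgroupOf B)
  change A.relIndex B = p ^ n at hn
  rw [← h1]
  apply Nat.mul_le_mul_right
  rw [hn]
  rcases Nat.eq_zero_or_pos n with h0 | h0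
  · exfalso
    rw [h0, pow_zero, Subgroup.relIndex_eq_one] at hn
    exact hu' (hn hu)
  · exact Nat.le_self_pow h0.ne' p

lemma exists_of_card_lt {A B : Subgroup G} [Finite G] (h : Nat.card A < Nat.card B) :
    ∃ u ∈ B, u ∉ A := by
  by_contra hc
  push Not at hc
  have : B ≤ A := hc
  exact absurd (Subgroup.card_le_of_le this) (by omega)

lemma card_ker_le [Finite G] {G' : Type*} [Group G'] [Finite G'] (f : G →* G') (Z : Subgroup G')
    (h : ∀ g, f g ∈ Z) : Nat.card G ≤ Nat.card Z * Nat.card f.ker := by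
  rw [← f.ker.card_mul_index, Subgroup.index_ker, mul_comm]
  apply Nat.mul_le_mul_right
  apply Subgroup.card_le_of_le
  rintro _ ⟨g, rfl⟩; exact h g

lemma card_inf_le [Finite G] (A B : Subgroup G) (a b : ℕ) (hA : Nat.card G ≤ a * Nat.card A)
    (hB : Nat.card G ≤ b * Nat.card B) : Nat.card G ≤ a * b * Nat.card (A ⊓ B : Subgroup G) := by
  have hA' : A.index ≤ a := by
    rw [← A.card_mul_index, mul_comm a] at hA
    exact Nat.le_of_mul_le_mul_left hA Nat.card_pos
  have hB' : B.index ≤ b := by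
    rw [← B.card_mul_index, mul_comm b] at hB
    exact Nat.le_of_mul_le_mul_left hB Nat.card_pos
  have := Subgroup.index_inf_le (H := A) (K := B)
  rw [← (A ⊓ B).card_mul_index, mul_comm (a*b)]
  apply Nat.mul_le_mul_left
  exact this.trans (Nat.mul_le_mul hA' hB')

lemma exists_ext (A : Subgroup G) (u : G) (h : ∀ a ∈ A, Commute a u) :
    ∃ B : Subgroup G, A ≤ B ∧ u ∈ B ∧ ∀ g ∈ B, ∃ a ∈ A, ∃ i : ℤ, g = a * u ^ i := by
  refine ⟨⟨⟨⟨{g | ∃ a ∈ A, ∃ i : ℤ, g = a * u ^ i}, ?_⟩, ?_⟩, ?_⟩, ?_, ?_, ?_⟩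
  · rintro _ _ ⟨a, ha, i, rfl⟩ ⟨b, hb, j, rfl⟩
    refine ⟨a * b, A.mul_mem ha hb, i + j, ?_⟩
    have := ((h b hb).zpow_right i).eq
    calc a * u ^ i * (b * u ^ j) = a * (u ^ i * b) * u ^ j := by group
      _ = _ := by rw [← this, zpow_add]; group
  · exact ⟨1, A.one_mem, 0, by simp⟩
  · rintro _ ⟨a, ha, i, rfl⟩
    refine ⟨a⁻¹, A.inv_mem ha, -i, ?_⟩
    have := ((h _ (A.inv_mem ha)).zpow_right (-i)).eq
    rw [this, mul_inv_rev, zpow_neg]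
  · intro a ha; exact ⟨a, ha, 0, by simp⟩
  · exact ⟨1, A.one_mem, 1, by simp⟩
  · intro g hg; exact hg

/-- abelian subgroup of exponent `p` -/
def EA (p : ℕ) (A : Subgroup G) : Prop := (∀ a ∈ A, ∀ b ∈ A, Commute a b) ∧ ∀ a ∈ A, a ^ p = 1

lemma EA_ext {p : ℕ} {A : Subgroup G} (hA : EA p A) {u : G} (h : ∀ a ∈ A, Commute a u)
    (hu : u ^ p = 1) :
    ∃ B : Subgroup G, EA p B ∧ A ≤ B ∧ u ∈ B ∧ ∀ g ∈ B, ∃ a ∈ A, ∃ i : ℤ, g = a * u ^ i := by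
  obtain ⟨B, h1, h2, h3⟩ := exists_ext A u h
  refine ⟨B, ⟨?_, ?_⟩, h1, h2, h3⟩
  · intro x hx y hy
    obtain ⟨a, ha, i, rfl⟩ := h3 x hx
    obtain ⟨b, hb, j, rfl⟩ := h3 y hy
    apply Commute.mul_left
    · exact (hA.1 a ha b hb).mul_right ((h a ha).zpow_right j)
    · exact (((h b hb).symm.zpow_left i)).mul_right (((Commute.refl u).zpow_left i).zpow_right j)
  · intro x hx
    obtain ⟨a, ha, i, rfl⟩ := h3 x hx
    rw [((h a ha).zpow_right i).mul_pow, hA.2 a ha, one_mul, ← zpow_natCast, ← zpow_mul, mul_comm,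
      zpow_mul, zpow_natCast, hu, one_zpow]

lemma zpow_eq_one_of {p : ℕ} (hp : p.Prime) {g : G} (h : g ^ p = 1) {i : ℤ} (hi : g ^ i = 1)
    (hpi : ¬ (p : ℤ) ∣ i) : g = 1 := by
  by_contra hg
  have : Fact p.Prime := ⟨hp⟩
  have := orderOf_eq_prime h hg
  apply hpi
  rw [← this]
  exact orderOf_dvd_iff_zpow_eq_one.2 hi

lemma zpow_mem_of {p : ℕ} (hp : p.Prime) {A : Subgroup G} {g : G} (h : g ^ p ∈ A) {i : ℤ}
    (hi : g ^ i ∈ A) (hpi : ¬ (p : ℤ) ∣ i) : g ∈ A := by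
  have hc : IsCoprime (p : ℤ) i := (Nat.prime_iff_prime_int.1 hp).coprime_iff_not_dvd.2 hpi
  obtain ⟨a, b, hab⟩ := hc
  have : g = (g ^ p) ^ a * (g ^ i) ^ b := by
    rw [← zpow_natCast, ← zpow_mul, ← zpow_mul, ← zpow_add, mul_comm _ a, mul_comm _ b, hab,
      zpow_one]
  rw [this]
  exact A.mul_mem (A.zpow_mem h _) (A.zpow_mem hi _)

lemma zpow_mem_of_dvd {p : ℕ} {A : Subgroup G} {g : G} (h : g ^ p ∈ A) {i : ℤ}
    (hpi : (p : ℤ) ∣ i) : g ^ i ∈ A := by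
  obtain ⟨r, rfl⟩ := hpi
  rw [zpow_mul, zpow_natCast]; exact A.zpow_mem h _

lemma zpow_eq_of_dvd {p : ℕ} {g : G} (h : g ^ p = 1) {i j : ℤ}
    (hpi : (p : ℤ) ∣ i - j) : g ^ i = g ^ j := by
  have : g ^ (i - j) = 1 := by
    obtain ⟨r, hr⟩ := hpi
    rw [hr, zpow_mul, zpow_natCast, h, one_zpow]
  rwa [zpow_sub, mul_inv_eq_one] at this

lemma gen_of_card {p : ℕ} (hp : p.Prime) {Z : Subgroup G} (hZ : Nat.card Z = p) {z : G}
    (hz : z ∈ Z) (h1 : z ≠ 1) {w : G} (hw : w ∈ Z) : ∃ i : ℤ, w = z ^ i := by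
  have : Fact p.Prime := ⟨hp⟩
  have := mem_zpowers_of_prime_card (G := Z) hZ (g := ⟨z, hz⟩) (g' := ⟨w, hw⟩)
    (by intro h; exact h1 (congrArg Subtype.val h))
  obtain ⟨i, hi⟩ := this
  exact ⟨i, by simpa using (congrArg Subtype.val hi).symm⟩

lemma pow_card_one {p : ℕ} {Z : Subgroup G} (hZ : Nat.card Z = p) {z : G}
    (hz : z ∈ Z) : z ^ p = 1 := by
  have := pow_card_eq_one' (x := (⟨z, hz⟩ : Z))
  rw [hZ] at this
  simpa using congrArg Subtype.val this

/-- coprime action: no Jordan blocks -/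
lemma semisimple {p q : ℕ} (hp : p.Prime) (hpq : ¬ p ∣ q) (hq0 : q ≠ 0) {k : ℤ}
    (hk : (p : ℤ) ∣ k ^ q - 1)
    (α : G →* G) {x d : G} (hx : x ^ p = 1) (hd : d ^ p = 1) (hc : Commute x d)
    (h1 : α x = x ^ k * d) (h2 : α d = d ^ k) (hq : α^[q] x = x) : d = 1 := by
  have form : ∀ n : ℕ, α^[n+1] x = x ^ (k ^ (n+1)) * d ^ ((n+1 : ℤ) * k ^ n) := by
    intro n
    induction n with
    | zero => simp [h1]
    | succ n ih =>
      rw [Function.iterate_succ_apply', ih, map_mul, map_zpow, map_zpow, h1, h2,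
        (hc.zpow_left k).mul_zpow, ← zpow_mul, ← zpow_mul, mul_assoc, ← zpow_add]
      congr 2
      · ring
      · push_cast; ring
  obtain ⟨m, rfl⟩ := Nat.exists_eq_succ_of_ne_zero hq0
  have h := form m
  rw [hq, zpow_eq_of_dvd hx hk, zpow_one] at h
  have h' := left_eq_mul.1 h
  refine zpow_eq_one_of hp hd h' ?_
  have hpp := Nat.prime_iff_prime_int.1 hp
  intro hdv
  rcases hpp.dvd_or_dvd hdv with h3 | h3
  · apply hpq; exact_mod_cast h3
  · have h4 := hpp.dvd_of_dvd_pow h3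
    have h5 : (p : ℤ) ∣ k ^ m.succ := dvd_pow h4 (by simp)
    have h6 := dvd_sub h5 hk
    simp only [sub_sub_cancel] at h6
    exact hpp.not_isUnit (isUnit_of_dvd_one h6)
end basics
end MP


namespace MP
open scoped commutatorElement

/-- working form of a maximal pair -/
structure GP (p q : ℕ) (k : ℤ) (P : Type*) [Group P] (α : P →* P) (F : Subgroup P) : Prop where
  hp : p.Prime
  h3 : 3 < p
  hq : q.Prime
  hqp : q ∣ p - 1
  fin : Finite P
  pg : IsPGroup p P
  αq : ∀ x : P, α^[q] x = x
  hk : ¬ (p : ℤ) ∣ k - 1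
  Fα : ∀ x ∈ F, α x ∈ F
  Fcomm : ∀ a b : P, ⁅a, b⁆ ∈ F
  Fpow : ∀ a : P, a ^ p ∈ F
  Fcard : Nat.card P = p ^ 3 * Nat.card F
  sc : ∀ x : P, α x * (x ^ k)⁻¹ ∈ F
  R : ∀ H K : Subgroup P, K ≤ H → (∀ a ∈ H, ∀ b ∈ H, ⁅a, b⁆ ∈ K) → (∀ a ∈ H, a ^ p ∈ K) →
    Nat.card H ≤ p ^ 3 * Nat.card K
  M : ∀ H K : Subgroup P, H ≠ ⊤ → (∀ x ∈ H, α x ∈ H) → K ≤ H →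
    (∀ a ∈ H, ∀ b ∈ H, ⁅a, b⁆ ∈ K) → (∀ a ∈ H, a ^ p ∈ K) →
    p ^ 3 * Nat.card K ≤ Nat.card H → (∀ x ∈ H, α x * (x ^ k)⁻¹ ∈ K) → False

variable {p q : ℕ} {k : ℤ} {P : Type*} [Group P] {α : P →* P} {F : Subgroup P}

lemma card_comap_mk [Finite P] (N : Subgroup P) [N.Normal] (H : Subgroup (P ⧸ N)) :
    Nat.card (H.comap (QuotientGroup.mk' N)) = Nat.card N * Nat.card H := by
  have h1 := (H.comap (QuotientGroup.mk' N)).card_mul_index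
  rw [Subgroup.index_comap_of_surjective _ (QuotientGroup.mk'_surjective N)] at h1
  have h2 := H.card_mul_index
  have h3 := N.card_mul_index
  have h4 : N.index = Nat.card (P ⧸ N) := rfl
  rw [h4, ← h2, ← mul_assoc, ← h1] at h3
  exact (Nat.eq_of_mul_eq_mul_right (Nat.pos_of_ne_zero Subgroup.FiniteIndex.index_ne_zero) h3).symm

lemma GP.quot (h : GP p q k P α F) (N : Subgroup P) [N.Normal] (hN : N ≤ N.comap α) (hNF : N ≤ F) :
    GP p q k (P ⧸ N) (QuotientGroup.map N N α hN) (F.map (QuotientGroup.mk' N)) where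
  hp := h.hp
  h3 := h.h3
  hq := h.hq
  hqp := h.hqp
  fin := by have := h.fin; infer_instance
  pg := h.pg.to_quotient N
  αq := by
    have : ∀ n : ℕ, ∀ x : P, (QuotientGroup.map N N α hN)^[n] (x : P ⧸ N) = ((α^[n] x : P) : P ⧸ N) := by
      intro n
      induction n with
      | zero => intro x; rfl
      | succ n ih => intro x; rw [Function.iterate_succ_apply, QuotientGroup.map_mk, ih]; rfl
    intro x
    induction x using QuotientGroup.induction_on with | H x => rw [this, h.αq]
  hk := h.hk
  Fα := by
    rintro _ ⟨x, hx, rfl⟩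
    exact ⟨α x, h.Fα x hx, rfl⟩
  Fcomm := by
    intro a b
    induction a using QuotientGroup.induction_on with | H a =>
    induction b using QuotientGroup.induction_on with | H b =>
    exact ⟨⁅a, b⁆, h.Fcomm a b, rfl⟩
  Fpow := by
    intro a
    induction a using QuotientGroup.induction_on with | H a =>
    exact ⟨a ^ p, h.Fpow a, rfl⟩
  Fcard := by
    have := h.fin
    have h1 := card_comap_mk N (F.map (QuotientGroup.mk' N))
    rw [Subgroup.comap_map_eq, QuotientGroup.ker_mk', sup_eq_left.2 hNF] at h1
    have h2 := N.card_mul_index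
    have h4 : N.index = Nat.card (P ⧸ N) := rfl
    rw [h.Fcard, h1, h4] at h2
    have h5 : Nat.card N * Nat.card (P ⧸ N) =
      Nat.card N * (p ^ 3 * Nat.card (F.map (QuotientGroup.mk' N))) := by rw [h2]; ring
    exact Nat.eq_of_mul_eq_mul_left Nat.card_pos h5
  sc := by
    intro x
    induction x using QuotientGroup.induction_on with | H x =>
    exact ⟨_, h.sc x, rfl⟩
  R := by
    intro H K hKH h1 h2
    have := h.fin
    have h5 := h.R (H.comap (QuotientGroup.mk' N)) (K.comap (QuotientGroup.mk' N))
      (Subgroup.comap_mono hKH) (fun a ha b hb => h1 _ ha _ hb) (fun a ha => h2 _ ha)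
    rw [card_comap_mk, card_comap_mk] at h5
    refine Nat.le_of_mul_le_mul_left ?_ (Nat.card_pos (α := N))
    calc _ ≤ _ := h5
      _ = _ := by ring
  M := by
    intro H K hH hHα hKH h1 h2 hc hs
    have := h.fin
    refine h.M (H.comap (QuotientGroup.mk' N)) (K.comap (QuotientGroup.mk' N)) ?_
      (fun x hx => hHα _ hx)
      (Subgroup.comap_mono hKH) (fun a ha b hb => h1 _ ha _ hb) (fun a ha => h2 _ ha) ?_
      (fun x hx => hs _ hx)
    · intro ht
      apply hH
      rw [eq_top_iff]
      intro x _
      induction x using QuotientGroup.induction_on with | H x =>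
      have : x ∈ H.comap (QuotientGroup.mk' N) := by rw [ht]; trivial
      exact this
    · rw [card_comap_mk, card_comap_mk]
      calc _ = Nat.card N * (p ^ 3 * Nat.card K) := by ring
        _ ≤ _ := Nat.mul_le_mul_left _ hc

lemma GP.Fn (h : GP p q k P α F) : F.Normal := by
  constructor
  intro n hn g
  have : g * n * g⁻¹ = ⁅g, n⁆ * n := by rw [commutatorElement_def]; group
  rw [this]; exact F.mul_mem (h.Fcomm _ _) hn

lemma GP.ne_top (h : GP p q k P α F) : ∃ x, x ∉ F := by
  by_contra hc
  push Not at hc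
  have : F = ⊤ := by rw [eq_top_iff]; intro x _; exact hc x
  have h1 := h.Fcard
  have := h.fin
  rw [‹F = ⊤›, Subgroup.card_top] at h1
  have h2 : 1 < p ^ 3 := Nat.one_lt_pow (by norm_num) h.hp.one_lt
  have h3 : 0 < Nat.card P := Nat.card_pos
  nlinarith

lemma GP.scx (h : GP p q k P α F) (x : P) : ∃ f ∈ F, α x = x ^ k * f := by
  refine ⟨(x ^ k)⁻¹ * (α x * (x ^ k)⁻¹) * (x ^ k)⁻¹⁻¹, h.Fn.conj_mem _ (h.sc x) _, by group⟩

lemma GP.kq (h : GP p q k P α F) : (p : ℤ) ∣ k ^ q - 1 := by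
  obtain ⟨x, hx⟩ := h.ne_top
  have := h.Fn
  by_contra hc
  apply hx
  refine zpow_mem_of h.hp (h.Fpow x) (i := k ^ q - 1) ?_ hc
  have key : ∀ n : ℕ, ((α^[n] x : P) : P ⧸ F) = (x : P ⧸ F) ^ (k ^ n) := by
    intro n
    induction n with
    | zero => simp
    | succ n ih =>
      obtain ⟨f, hf, e⟩ := h.scx (α^[n] x)
      rw [Function.iterate_succ_apply', e, QuotientGroup.mk_mul, QuotientGroup.mk_zpow, ih,
        (QuotientGroup.eq_one_iff f).2 hf, mul_one, ← zpow_mul, pow_succ]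
  have h2 := key q
  rw [h.αq] at h2
  rw [← QuotientGroup.eq_one_iff, QuotientGroup.mk_zpow, zpow_sub, ← h2, zpow_one, mul_inv_cancel]

lemma GP.pk (h : GP p q k P α F) : ¬ (p : ℤ) ∣ k := by
  intro hd
  have h2 := dvd_sub (dvd_pow hd h.hq.ne_zero) h.kq
  rw [sub_sub_cancel] at h2
  exact (Nat.prime_iff_prime_int.1 h.hp).not_isUnit (isUnit_of_dvd_one h2)

lemma GP.pq (h : GP p q k P α F) : ¬ p ∣ q := by
  intro hd
  have h1 := Nat.le_of_dvd h.hq.pos hd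
  have h2 := Nat.le_of_dvd (by have := h.hp.one_lt; omega) h.hqp
  have := h.hp.one_lt; omega

lemma GP.M_ss (h : GP p q k P α F) (H K D : Subgroup P) [K.Normal] (hKα : K ≤ K.comap α)
    (hH : H ≠ ⊤) (hHα : ∀ x ∈ H, α x ∈ H) (hKH : K ≤ H)
    (h1 : ∀ a ∈ H, ∀ b ∈ H, ⁅a, b⁆ ∈ K) (h2 : ∀ a ∈ H, a ^ p ∈ K)
    (hc : p ^ 3 * Nat.card K ≤ Nat.card H) (hDH : D ≤ H)
    (hD : ∀ x ∈ H, α x * (x ^ k)⁻¹ ∈ D) (hDK : ∀ d ∈ D, α d * (d ^ k)⁻¹ ∈ K) : False := by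
  refine h.M H K hH hHα hKH h1 h2 hc ?_
  intro x hx
  have cm : ∀ a ∈ H, ∀ b ∈ H, (a : P ⧸ K) * b = b * a := by
    intro a ha b hb
    rw [← commutatorElement_eq_one_iff_mul_comm]
    exact (QuotientGroup.eq_one_iff _).2 (h1 a ha b hb)
  have pw : ∀ a ∈ H, (a : P ⧸ K) ^ p = 1 := fun a ha => (QuotientGroup.eq_one_iff _).2 (h2 a ha)
  rw [← QuotientGroup.eq_one_iff]
  have hdH := hDH (hD x hx)
  refine semisimple h.hp h.pq h.hq.ne_zero h.kq (QuotientGroup.map K K α hKα) (pw x hx) (pw _ hdH)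
    (cm x hx _ hdH) ?_ ?_ ?_
  · have : (α x : P ⧸ K) = (α x * (x ^ k)⁻¹ : P) * (x ^ k : P) := by
      rw [← QuotientGroup.mk_mul]; congr 1; group
    rw [QuotientGroup.map_mk, this, cm _ hdH _ (H.zpow_mem hx k)]; rfl
  · have := (QuotientGroup.eq_one_iff _).2 (hDK _ (hD x hx))
    rw [QuotientGroup.map_mk]
    exact mul_inv_eq_one.1 this
  · have : ∀ n : ℕ, ∀ x : P, (QuotientGroup.map K K α hKα)^[n] (x : P ⧸ K) = ((α^[n] x : P) : P ⧸ K) := by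
      intro n
      induction n with
      | zero => intro x; rfl
      | succ n ih => intro x; rw [Function.iterate_succ_apply, QuotientGroup.map_mk, ih]; rfl
    rw [this, h.αq]

/-- no elementary abelian subgroup of order `p^4` -/
lemma GP.R4 (h : GP p q k P α F) {E : Subgroup P} (hE : EA p E) (hc : p ^ 4 ≤ Nat.card E) :
    False := by
  have h1 := h.R E ⊥ bot_le (fun a ha b hb => by
    rw [Subgroup.mem_bot, commutatorElement_eq_one_iff_mul_comm]; exact hE.1 a ha b hb)
    (fun a ha => by rw [Subgroup.mem_bot]; exact hE.2 a ha)
  rw [Subgroup.card_bot, mul_one] at h1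
  have : p ^ 3 < p ^ 4 := Nat.pow_lt_pow_right h.hp.one_lt (by norm_num)
  omega

lemma GP.red (h : GP p q k P α F) (hF : F ≠ ⊥) :
    ∃ N : Subgroup P, N ≤ F ∧ N ≤ Subgroup.center P ∧ Nat.card N = p ∧ N ≤ N.comap α := by
  have := h.fin
  have hpF : Fact p.Prime := ⟨h.hp⟩
  have := h.Fn
  -- nontrivial central element in F
  obtain ⟨c, hcF, hcZ, hc1⟩ : ∃ c ∈ F, c ∈ Subgroup.center P ∧ c ≠ 1 := by
    have hd : p ∣ Nat.card F := by
      rcases (h.pg.to_subgroup F).card_eq_or_dvd with h1 | h1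
      · exact absurd (Subgroup.eq_bot_of_card_eq F h1) hF
      · exact h1
    obtain ⟨b, hb, hb1⟩ := (h.pg.of_equiv ConjAct.toConjAct).exists_fixed_point_of_prime_dvd_card_of_fixed_point
      F hd (a := 1) (by intro g; simp)
    refine ⟨b, b.2, ?_, fun h0 => hb1 (Subtype.ext h0.symm)⟩
    rw [Subgroup.mem_center_iff]
    intro g
    have := congrArg Subtype.val (hb (ConjAct.toConjAct g))
    rw [ConjAct.Subgroup.val_conj_smul, ConjAct.toConjAct_smul] at this
    rw [mul_inv_eq_iff_eq_mul] at this
    exact this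
  have αsurj : Function.Surjective α := by
    intro x
    refine ⟨α^[q-1] x, ?_⟩
    rw [← Function.iterate_succ_apply' (f := α)]
    have : (q - 1).succ = q := by have := h.hq.one_lt; omega
    rw [this, h.αq]
  let W : Subgroup P :=
    { carrier := {g | g ∈ F ∧ g ∈ Subgroup.center P ∧ g ^ p = 1}
      mul_mem' := by
        rintro a b ⟨h1, h2, h3⟩ ⟨h4, h5, h6⟩
        refine ⟨F.mul_mem h1 h4, Subgroup.mul_mem _ h2 h5, ?_⟩
        have : Commute a b := ((Subgroup.mem_center_iff.1 h2) b).symm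
        rw [this.mul_pow, h3, h6, one_mul]
      one_mem' := ⟨F.one_mem, Subgroup.one_mem _, one_pow _⟩
      inv_mem' := by
        rintro a ⟨h1, h2, h3⟩
        exact ⟨F.inv_mem h1, Subgroup.inv_mem _ h2, by rw [inv_pow, h3, inv_one]⟩ }
  have hWm : ∀ g, g ∈ W ↔ g ∈ F ∧ g ∈ Subgroup.center P ∧ g ^ p = 1 := fun g => Iff.rfl
  let _ : CommGroup W := { (inferInstance : Group W) with
    mul_comm := by
      intro a b
      exact Subtype.ext ((Subgroup.mem_center_iff.1 b.2.2.1) a) }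
  have hWα : ∀ g ∈ W, α g ∈ W := by
    rintro g ⟨h1, h2, h3⟩
    refine ⟨h.Fα g h1, ?_, ?_⟩
    · rw [Subgroup.mem_center_iff]
      intro x
      obtain ⟨y, rfl⟩ := αsurj x
      rw [← map_mul, ← map_mul, (Subgroup.mem_center_iff.1 h2) y]
    · rw [← map_pow, h3, map_one]
  let β : W →* W := (α.comp W.subtype).codRestrict W (fun x => hWα x x.2)
  have hβ : ∀ n : ℕ, ∀ w : W, ((β^[n] w : W) : P) = α^[n] w := by
    intro n
    induction n with
    | zero => intro w; rfl
    | succ n ih => intro w; rw [Function.iterate_succ_apply, ih]; rfl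
  have : Nontrivial W := by
    obtain ⟨n, hn⟩ := (IsPGroup.iff_orderOf.1 h.pg c)
    have hn0 : n ≠ 0 := by
      rintro rfl
      rw [pow_zero, orderOf_eq_one_iff] at hn
      exact hc1 hn
    refine ⟨⟨⟨c ^ p ^ (n - 1), F.pow_mem hcF _, Subgroup.pow_mem _ hcZ _, ?_⟩, 1, ?_⟩⟩
    · rw [← pow_mul, ← pow_succ, Nat.sub_add_cancel (Nat.pos_of_ne_zero hn0), ← hn, pow_orderOf_eq_one]
    · intro h0
      have h1 := orderOf_dvd_of_pow_eq_one (congrArg Subtype.val h0)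
      rw [hn] at h1
      have h2 := (Nat.pow_dvd_pow_iff_le_right h.hp.one_lt).1 h1
      omega
  obtain ⟨w, hw1, m, hm⟩ := eigen_exists h.hp h.hqp (W := W)
    (fun w => Subtype.ext w.2.2.2) β (fun w => Subtype.ext (by rw [hβ, h.αq]))
  have hw1' : (w : P) ≠ 1 := fun h0 => hw1 (Subtype.ext h0)
  have hm' : α w = (w : P) ^ m := congrArg Subtype.val hm
  refine ⟨Subgroup.zpowers (w : P), ?_, ?_, ?_, ?_⟩
  · rw [Subgroup.zpowers_le]; exact w.2.1
  · rw [Subgroup.zpowers_le]; exact w.2.2.1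
  · rw [Nat.card_zpowers]; exact orderOf_eq_prime w.2.2.2 hw1'
  · rw [Subgroup.zpowers_le, Subgroup.mem_comap, hm']
    exact Subgroup.pow_mem _ (Subgroup.mem_zpowers _) m

end MP


namespace MP
open scoped commutatorElement

variable {p q : ℕ} {k : ℤ} {P : Type*} [Group P] {α : P →* P} {F : Subgroup P}

/-- `g ↦ ⁅g, b⁆` -/
def cH (b : P) (hb : ∀ g : P, ⁅g, b⁆ ∈ Subgroup.center P) : P →* P where
  toFun g := ⁅g, b⁆
  map_one' := by rw [commutatorElement_one_left]
  map_mul' x y := comm_mul_left (hb y)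

lemma mem_cH {b : P} {hb : ∀ g : P, ⁅g, b⁆ ∈ Subgroup.center P} {g : P} :
    g ∈ (cH b hb).ker ↔ Commute g b := by
  rw [MonoidHom.mem_ker, ← commutatorElement_eq_one_iff_commute]; rfl

/-- `g ↦ g ^ p` -/
def pH (p : ℕ) (h : ∀ a b : P, (a * b) ^ p = a ^ p * b ^ p) : P →* P where
  toFun g := g ^ p
  map_one' := one_pow _
  map_mul' := h

lemma mem_pH {h : ∀ a b : P, (a * b) ^ p = a ^ p * b ^ p} {g : P} :
    g ∈ (pH p h).ker ↔ g ^ p = 1 := by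
  rw [MonoidHom.mem_ker]; rfl

lemma cen_comm {z : P} (h : z ∈ Subgroup.center P) (g : P) : Commute z g :=
  ((Subgroup.mem_center_iff.1 h) g).symm

lemma GP.pp (h : GP p q k P α F) : Prime (p : ℤ) := Nat.prime_iff_prime_int.1 h.hp

lemma zpow_ne {p : ℕ} (hp : p.Prime) {g : P} (h : g ^ p = 1) {i j : ℤ} (hi : g ^ i = g ^ j)
    (hpi : ¬ (p : ℤ) ∣ i - j) : g = 1 :=
  zpow_eq_one_of hp h (by rw [zpow_sub, hi, mul_inv_cancel]) hpi

lemma GP.kk1 (h : GP p q k P α F) : ¬ (p : ℤ) ∣ k * k - k := by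
  intro hd
  have : k * k - k = k * (k - 1) := by ring
  rw [this] at hd
  rcases h.pp.dvd_or_dvd hd with h1 | h1
  · exact h.pk h1
  · exact h.hk h1

lemma GP.αcomm (h : GP p q k P α F) (hF : F ≤ Subgroup.center P) (a b : P) :
    α ⁅a, b⁆ = ⁅a, b⁆ ^ (k * k) := by
  obtain ⟨f, hf, e1⟩ := h.scx a
  obtain ⟨g, hg, e2⟩ := h.scx b
  rw [map_commutatorElement, e1, e2]
  exact comm_eig (hF (h.Fcomm _ _)) _ _ (cen_comm (hF hf) _) (cen_comm (hF hf) _)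
    (cen_comm (hF hg) _).symm

lemma comm_exp {x : P} (h : ∀ a b : P, (a * b) ^ p = a ^ p * b ^ p) (hα : ∃ f, α x = x ^ k * f ∧ f ^ p = 1) :
    α (x ^ p) = (x ^ p) ^ k := by
  obtain ⟨f, e, hf⟩ := hα
  rw [map_pow, e, h, hf, mul_one, ← zpow_natCast, ← zpow_natCast, ← zpow_mul, ← zpow_mul, mul_comm]

lemma L4 (h : GP p q k P α F) (hc : Nat.card P = p ^ 4) : (∀ g : P, g ^ p = 1) ∧
    F ≤ Subgroup.center P ∧ (∀ f ∈ F, α f = f ^ (k * k)) ∧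
    ∃ x y z : P, ⁅x, y⁆ ≠ 1 ∧ z ∈ Subgroup.center P ∧ z ∉ F := by
  have := h.fin
  have p0 := h.hp.pos
  have p1 := h.hp.one_lt
  have cF : Nat.card F = p := by
    have := h.Fcard
    rw [hc, pow_succ] at this
    exact (Nat.eq_of_mul_eq_mul_left (by positivity) this).symm
  have hFZ : F ≤ Subgroup.center P := by
    obtain ⟨N, h1, h2, h3, h4⟩ := h.red (by
      rintro rfl
      rw [Subgroup.card_bot] at cF
      omega)
    rw [← Subgroup.eq_of_le_of_card_ge h1 (by omega)]
    exact h2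
  have Fp : ∀ f ∈ F, f ^ p = 1 := fun f hf => pow_card_one cF hf
  obtain ⟨-, -, hom⟩ := pow_hom h.hp h.h3 (fun g => hFZ (h.Fpow g))
    (fun a b g => hFZ (h.Fcomm _ _))
  have hαp : ∀ x, α (x ^ p) = (x ^ p) ^ k := by
    intro x
    obtain ⟨f, hf, e⟩ := h.scx x
    exact comm_exp hom ⟨f, e, Fp f hf⟩
  have hex : ∀ g : P, g ^ p = 1 := by
    by_contra hne
    push Not at hne
    obtain ⟨a, ha⟩ := hne
    have αF : ∀ f ∈ F, α f = f ^ k := by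
      intro f hf
      obtain ⟨i, rfl⟩ := gen_of_card h.hp cF (h.Fpow a) ha hf
      rw [map_zpow, hαp, ← zpow_mul, ← zpow_mul, mul_comm]
    have ab : ∀ x y : P, ⁅x, y⁆ = 1 := fun x y =>
      zpow_ne h.hp (Fp _ (h.Fcomm x y)) ((h.αcomm hFZ x y).symm.trans (αF _ (h.Fcomm x y))) h.kk1
    refine h.M_ss (pH p hom).ker ⊥ F (by simp) ?_ ?_ bot_le ?_ ?_ ?_ ?_ ?_ ?_
    · intro ht
      apply ha
      rw [← mem_pH (h := hom), ht]; trivial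
    · intro x hx
      rw [mem_pH] at *
      rw [← map_pow, hx, map_one]
    · intro a _ b _; rw [ab]; exact Subgroup.one_mem _
    · intro a ha; rw [mem_pH] at ha; rw [ha]; exact Subgroup.one_mem _
    · have := card_ker_le (pH p hom) F (fun g => h.Fpow g)
      rw [hc, cF, pow_succ, mul_comm] at this
      rw [Subgroup.card_bot, mul_one]
      exact Nat.le_of_mul_le_mul_left this p0
    · intro f hf; rw [mem_pH]; exact Fp f hf
    · intro x hx; exact h.sc x
    · intro d hd; rw [αF d hd, mul_inv_cancel]; exact Subgroup.one_mem _
  obtain ⟨x, y, hxy⟩ : ∃ x y : P, ⁅x, y⁆ ≠ 1 := by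
    by_contra hne
    push Not at hne
    refine h.R4 (E := ⊤) ⟨fun a _ b _ => ?_, fun a _ => hex a⟩ ?_
    · rw [← commutatorElement_eq_one_iff_commute]; exact hne a b
    · rw [Subgroup.card_top, hc]
  have cz : ∀ b g : P, ⁅g, b⁆ ∈ Subgroup.center P := fun b g => hFZ (h.Fcomm _ _)
  have hxy' : ¬ Commute x y := by rwa [← commutatorElement_eq_one_iff_commute]
  obtain ⟨z, hz, hzF⟩ : ∃ z ∈ (cH x (cz x)).ker ⊓ (cH y (cz y)).ker, z ∉ F := by
    apply exists_of_card_lt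
    have := card_inf_le (cH x (cz x)).ker (cH y (cz y)).ker p p
      (by rw [← cF]; exact card_ker_le _ F (fun g => h.Fcomm _ _))
      (by rw [← cF]; exact card_ker_le _ F (fun g => h.Fcomm _ _))
    rw [hc] at this
    have h2 : p * p ≤ Nat.card ((cH x (cz x)).ker ⊓ (cH y (cz y)).ker : Subgroup P) := by
      refine Nat.le_of_mul_le_mul_left (c := p * p) ?_ (by positivity)
      calc _ = p ^ 4 := by ring
        _ ≤ _ := this
    rw [cF]
    nlinarith
  rw [Subgroup.mem_inf, mem_cH, mem_cH] at hz
  refine ⟨hex, hFZ, ?_, x, y, z, hxy, ?_, hzF⟩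
  · intro f hf
    obtain ⟨i, rfl⟩ := gen_of_card h.hp cF (h.Fcomm x y) hxy hf
    rw [map_zpow, h.αcomm hFZ, ← zpow_mul, ← zpow_mul, mul_comm]
  · have c1 : p * Nat.card F ≤ Nat.card ((cH z (cz z)).ker ⊓ (cH x (cz x)).ker ⊓ (cH y (cz y)).ker : Subgroup P) := by
      refine card_lt h.hp h.pg (u := z) ?_ ?_ hzF
      · intro f hf
        simp only [Subgroup.mem_inf, mem_cH]
        exact ⟨⟨cen_comm (hFZ hf) _, cen_comm (hFZ hf) _⟩, cen_comm (hFZ hf) _⟩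
      · simp only [Subgroup.mem_inf, mem_cH]
        exact ⟨⟨Commute.refl _, hz.1⟩, hz.2⟩
    have c2 := card_lt h.hp h.pg (A := (cH z (cz z)).ker ⊓ (cH x (cz x)).ker ⊓ (cH y (cz y)).ker)
      (B := (cH z (cz z)).ker ⊓ (cH x (cz x)).ker) (u := x) inf_le_left
      (by simp only [Subgroup.mem_inf, mem_cH]; exact ⟨hz.1.symm, Commute.refl _⟩)
      (by simp only [Subgroup.mem_inf, mem_cH]; exact fun h => hxy' h.2)
    have c3 := card_lt h.hp h.pg (A := (cH z (cz z)).ker ⊓ (cH x (cz x)).ker)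
      (B := (cH z (cz z)).ker) (u := y) inf_le_left
      (by simp only [mem_cH]; exact hz.2.symm)
      (by simp only [Subgroup.mem_inf, mem_cH]; exact fun h => hxy' h.2.symm)
    have c4 : (cH z (cz z)).ker = ⊤ := by
      apply Subgroup.eq_top_of_le_card
      rw [hc]
      rw [cF] at c1
      calc p ^ 4 = p * (p * (p * p)) := by ring
        _ ≤ _ := (Nat.mul_le_mul_left p ((Nat.mul_le_mul_left p c1).trans c2)).trans c3
    rw [Subgroup.mem_center_iff]
    intro g
    have : g ∈ (cH z (cz z)).ker := by rw [c4]; trivial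
    rw [mem_cH] at this
    exact this.eq

end MP


namespace MP
open scoped commutatorElement

variable {p q : ℕ} {k : ℤ} {P : Type*} [Group P] {α : P →* P} {F Z : Subgroup P} {x y z : P}

lemma comm_cen {u v : P} (hu : u ∈ Subgroup.center P) (hv : v ∈ Subgroup.center P) (x y : P) :
    ⁅u * x, v * y⁆ = ⁅x, y⁆ := by
  have e1 : ∀ a : P, ⁅a, v * y⁆ = ⁅a, y⁆ := by
    intro a
    have : ⁅a, v * y⁆ = ⁅a, v⁆ * (v * ⁅a, y⁆ * v⁻¹) := by
      simp only [commutatorElement_def]; group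
    rw [this, (commutatorElement_eq_one_iff_commute.2 (cen_comm hv a).symm), one_mul,
      (cen_comm hv _).eq, mul_inv_cancel_right]
  have e2 : ⁅u * x, y⁆ = u * ⁅x, y⁆ * u⁻¹ * ⁅u, y⁆ := by
    simp only [commutatorElement_def]; group
  rw [e1, e2, (commutatorElement_eq_one_iff_commute.2 (cen_comm hu y)), mul_one,
      (cen_comm hu _).eq, mul_inv_cancel_right]

lemma comm_z (hz : ∀ g : P, ⁅z, g⁆ ∈ Subgroup.center P) (x y : P) : Commute z ⁅x, y⁆ := by
  have e : z * ⁅x, y⁆ * z⁻¹ = ⁅⁅z, x⁆ * x, ⁅z, y⁆ * y⁆ := by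
    simp only [commutatorElement_def]; group
  rw [comm_cen (hz x) (hz y)] at e
  exact mul_inv_eq_iff_eq_mul.1 e

lemma comm_swap_mem {a b : P} (h : ⁅a, b⁆ ∈ Z) : ⁅b, a⁆ ∈ Z := by
  rw [← commutatorElement_inv]; exact Z.inv_mem h

lemma GP.E_contr (h : GP p q k P α F) {A T : Subgroup P} (hA : EA p A) (cA : p ^ 3 ≤ Nat.card A)
    (hT : p ^ 4 ≤ Nat.card T) (h1 : ∀ t ∈ T, t ^ p = 1) (h2 : ∀ t ∈ T, ∀ a ∈ A, Commute a t) :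
    False := by
  have := h.fin
  by_cases hlt : Nat.card A < p ^ 4
  · obtain ⟨u, hu, hu'⟩ := exists_of_card_lt (lt_of_lt_of_le hlt hT)
    obtain ⟨B, hB, hAB, huB, -⟩ := EA_ext hA (h2 u hu) (h1 u hu)
    refine h.R4 hB ?_
    have := card_lt h.hp h.pg hAB huB hu'
    calc p ^ 4 = p * p ^ 3 := by ring
      _ ≤ p * Nat.card A := Nat.mul_le_mul_left _ cA
      _ ≤ _ := this
  · exact h.R4 hA (not_lt.1 hlt)

/-- working data in order `p^5` -/
structure Q5 (p q : ℕ) (k : ℤ) (P : Type*) [Group P] (α : P →* P) (F Z : Subgroup P)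
    (x y z : P) : Prop where
  ZF : Z ≤ F
  Zc : Z ≤ Subgroup.center P
  cZ : Nat.card Z = p
  Zα : Z ≤ Z.comap α
  cP : Nat.card P = p ^ 5
  cF : Nat.card F = p ^ 2
  pw : ∀ g : P, g ^ p ∈ Z
  Fg : ∀ f ∈ F, ∀ g : P, ⁅f, g⁆ ∈ Z
  Fk : ∀ f ∈ F, ∃ w ∈ Z, α f = f ^ (k * k) * w
  cnZ : ⁅x, y⁆ ∉ Z
  zZ : ∀ g : P, ⁅z, g⁆ ∈ Z
  zF : z ∉ F
  gen : ∀ f ∈ F, ∃ w ∈ Z, ∃ i : ℤ, f = w * ⁅x, y⁆ ^ i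
  Fea : EA p F
  zcF : ∀ f ∈ F, Commute f z
  hom : ∀ a b : P, (a * b) ^ p = a ^ p * b ^ p

lemma card_quot {m : ℕ} (p0 : 0 < p) [Finite P] (hc : Nat.card P = p ^ (m + 1)) {N : Subgroup P} (cN : Nat.card N = p) :
    Nat.card (P ⧸ N) = p ^ m := by
  have h2 := N.card_mul_index
  rw [cN, hc, pow_succ, mul_comm (p ^ m)] at h2
  exact Nat.eq_of_mul_eq_mul_left p0 h2

lemma GP.card_F {m : ℕ} (h : GP p q k P α F) (hc : Nat.card P = p ^ (m + 3)) : Nat.card F = p ^ m := by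
  have := h.Fcard
  have p0 := h.hp.pos
  rw [hc, pow_add, mul_comm] at this
  exact (Nat.eq_of_mul_eq_mul_left (by positivity) this).symm

lemma normal_of_center {N : Subgroup P} (h : N ≤ Subgroup.center P) : N.Normal := by
  constructor
  intro n hn g
  rw [← (cen_comm (h hn) g).eq, mul_inv_cancel_right]; exact hn

lemma mk_mem_center {N : Subgroup P} [N.Normal] {g : P} :
    (g : P ⧸ N) ∈ Subgroup.center (P ⧸ N) ↔ ∀ u : P, ⁅g, u⁆ ∈ N := by
  rw [Subgroup.mem_center_iff]
  constructor
  · intro h u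
    rw [← QuotientGroup.eq_one_iff]
    exact commutatorElement_eq_one_iff_mul_comm.2 (h u).symm
  · intro h u
    induction u using QuotientGroup.induction_on with | H u =>
    exact (commutatorElement_eq_one_iff_mul_comm.1 ((QuotientGroup.eq_one_iff _).2 (h u))).symm

lemma mk_mem_map {N K : Subgroup P} [N.Normal] (hNK : N ≤ K) {g : P} :
    (g : P ⧸ N) ∈ K.map (QuotientGroup.mk' N) ↔ g ∈ K := by
  have : (g : P ⧸ N) ∈ K.map (QuotientGroup.mk' N) ↔ g ∈ (K.map (QuotientGroup.mk' N)).comap (QuotientGroup.mk' N) := Iff.rfl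
  rw [this, Subgroup.comap_map_eq, QuotientGroup.ker_mk', sup_eq_left.2 hNK]

lemma GP.q5 (h : GP p q k P α F) (hc : Nat.card P = p ^ 5) :
    ∃ Z x y z, Q5 p q k P α F Z x y z := by
  have := h.fin
  have p0 := h.hp.pos
  have p1 := h.hp.one_lt
  have cF : Nat.card F = p ^ 2 := h.card_F hc
  obtain ⟨Z, ZF, Zc, cZ, Zα⟩ := h.red (by
      rintro rfl
      rw [Subgroup.card_bot] at cF
      nlinarith)
  have := normal_of_center Zc
  obtain ⟨h1, h2, h3, x, y, z, h4, h5, h6⟩ := L4 (h.quot Z Zα ZF) (card_quot p0 hc cZ)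
  induction x using QuotientGroup.induction_on with | H x =>
  induction y using QuotientGroup.induction_on with | H y =>
  induction z using QuotientGroup.induction_on with | H z =>
  have pw : ∀ g : P, g ^ p ∈ Z := fun g => by
    rw [← QuotientGroup.eq_one_iff]; exact h1 g
  have Fg : ∀ f ∈ F, ∀ g : P, ⁅f, g⁆ ∈ Z := fun f hf => by
    rw [← mk_mem_center]; exact h2 ⟨f, hf, rfl⟩
  have cnZ : ⁅x, y⁆ ∉ Z := by
    rw [← QuotientGroup.eq_one_iff]; exact h4
  have zZ := mk_mem_center.1 h5
  have zF : z ∉ F := by rwa [mk_mem_map ZF] at h6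
  obtain ⟨B, ZB, cB, hB⟩ := exists_ext Z ⁅x, y⁆ (fun w hw => cen_comm (Zc hw) _)
  have gen : ∀ f ∈ F, ∃ w ∈ Z, ∃ i : ℤ, f = w * ⁅x, y⁆ ^ i := by
    have BF : B ≤ F := by
      intro b hb
      obtain ⟨a, ha, i, rfl⟩ := hB b hb
      exact F.mul_mem (ZF ha) (F.zpow_mem (h.Fcomm x y) i)
    have : B = F := Subgroup.eq_of_le_of_card_ge BF (by
      have := card_lt h.hp h.pg ZB cB cnZ
      rw [cF, pow_two]; rwa [cZ] at this)
    rwa [this] at hB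
  obtain ⟨e1, -, hom⟩ := pow_hom h.hp h.h3 (fun g => Zc (pw g))
    (fun a b g => Zc (Fg _ (h.Fcomm _ _) g))
  have zc := comm_z (fun g => Zc (zZ g)) x y
  refine ⟨Z, x, y, z, ZF, Zc, cZ, Zα, hc, cF, pw, Fg, ?_, cnZ, zZ, zF, gen, ⟨?_, ?_⟩, ?_, hom⟩
  · intro f hf
    refine ⟨(f ^ (k * k))⁻¹ * α f, ?_, by group⟩
    have := h3 f ⟨f, hf, rfl⟩
    rw [← QuotientGroup.eq_one_iff, QuotientGroup.mk_mul, QuotientGroup.mk_inv, inv_mul_eq_one]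
    exact this.symm
  · intro a ha b hb
    obtain ⟨w, hw, i, rfl⟩ := gen a ha
    obtain ⟨w', hw', j, rfl⟩ := gen b hb
    refine (cen_comm (Zc hw) _).mul_left ((cen_comm (Zc hw') _).symm.mul_right ?_)
    exact ((Commute.refl ⁅x, y⁆).zpow_left i).zpow_right j
  · intro a ha
    obtain ⟨w, hw, i, rfl⟩ := gen a ha
    rw [hom, pow_card_one cZ hw, one_mul, ← zpow_natCast, ← zpow_mul, mul_comm, zpow_mul,
      zpow_natCast, e1, one_zpow]
  · intro f hf
    obtain ⟨w, hw, i, rfl⟩ := gen f hf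
    exact (cen_comm (Zc hw) _).mul_left (zc.symm.zpow_left i)

lemma GP.αp (h : GP p q k P α F) (s : Q5 p q k P α F Z x y z) (a : P) :
    α (a ^ p) = (a ^ p) ^ k := by
  obtain ⟨f, hf, e⟩ := h.scx a
  exact comm_exp s.hom ⟨f, e, s.Fea.2 f hf⟩

/-- if all scalars agree on one nontrivial element of `Z` then on all -/
lemma eig_all (hp : p.Prime) (cZ : Nat.card Z = p) {w : P} (hw : w ∈ Z) (w1 : w ≠ 1) {j : ℤ}
    (e : α w = w ^ j) : ∀ v ∈ Z, α v = v ^ j := by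
  intro v hv
  obtain ⟨i, rfl⟩ := gen_of_card hp cZ hw w1 hv
  rw [map_zpow, e, ← zpow_mul, ← zpow_mul, mul_comm]

/-- the subgroup `⟨F, z⟩` -/
lemma GP.Fz (h : GP p q k P α F) (s : Q5 p q k P α F Z x y z) (hz : z ^ p = 1) :
    ∃ A : Subgroup P, EA p A ∧ p ^ 3 ≤ Nat.card A ∧ ∀ g ∈ A, ∃ a ∈ F, ∃ i : ℤ, g = a * z ^ i := by
  have := h.fin
  obtain ⟨A, h1, h2, h3, h4⟩ := EA_ext s.Fea s.zcF hz
  refine ⟨A, h1, ?_, h4⟩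
  have := card_lt h.hp h.pg h2 h3 s.zF
  rw [s.cF] at this
  calc p ^ 3 = p * p ^ 2 := by ring
    _ ≤ _ := this

lemma Q5.card_ker (s : Q5 p q k P α F Z x y z) (p0 : 0 < p) [Finite P] (f : P →* P) (hf : ∀ g, f g ∈ Z) :
    p ^ 4 ≤ Nat.card f.ker := by
  have := card_ker_le f Z hf
  rw [s.cP, s.cZ, pow_succ, mul_comm] at this
  exact Nat.le_of_mul_le_mul_left this p0

lemma GP.caseI (h : GP p q k P α F) (s : Q5 p q k P α F Z x y z)
    (hc : ⁅x, y⁆ ∈ Subgroup.center P) : False := by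
  have := h.fin
  have p0 := h.hp.pos
  have p1 := h.hp.one_lt
  have hF : F ≤ Subgroup.center P := by
    intro f hf
    obtain ⟨w, hw, i, rfl⟩ := s.gen f hf
    exact Subgroup.mul_mem _ (s.Zc hw) (Subgroup.zpow_mem _ hc i)
  have zz : ∀ g : P, ⁅g, z⁆ ∈ Z := fun g => comm_swap_mem (s.zZ g)
  have Zp : ∀ w ∈ Z, w ^ p = 1 := fun w hw => s.Fea.2 w (s.ZF hw)
  have zcen : ∀ g : P, Commute g z := by
    by_contra hne
    push Not at hne
    obtain ⟨g, hg⟩ := hne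
    rw [← commutatorElement_eq_one_iff_commute] at hg
    have αZ := eig_all h.hp s.cZ (zz g) hg (h.αcomm hF g z)
    have ex : ∀ a : P, a ^ p = 1 := fun a =>
      zpow_ne h.hp (Zp _ (s.pw a)) ((αZ _ (s.pw a)).symm.trans (h.αp s a)) h.kk1
    obtain ⟨A, h1, h2, h3⟩ := h.Fz s (ex z)
    refine h.E_contr h1 h2 (s.card_ker p0 (cH z (fun g => s.Zc (zz g))) zz) (fun t _ => ex t) ?_
    intro t ht a ha
    rw [mem_cH] at ht
    obtain ⟨f, hf, i, rfl⟩ := h3 a ha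
    exact (cen_comm (hF hf) t).mul_left (ht.symm.zpow_left i)
  by_cases hz : z ^ p = 1
  · obtain ⟨A, h1, h2, h3⟩ := h.Fz s hz
    refine h.E_contr h1 h2 (s.card_ker p0 (pH p s.hom) s.pw) (fun t ht => mem_pH.1 ht) ?_
    intro t ht a ha
    obtain ⟨f, hf, i, rfl⟩ := h3 a ha
    exact (cen_comm (hF hf) t).mul_left ((zcen t).symm.zpow_left i)
  · have αZ := eig_all h.hp s.cZ (s.pw z) hz (h.αp s z)
    have hcK : Subgroup.zpowers ⁅x, y⁆ ≤ Subgroup.center P := by rwa [Subgroup.zpowers_le]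
    have := normal_of_center hcK
    have hcF : Subgroup.zpowers ⁅x, y⁆ ≤ F := by rw [Subgroup.zpowers_le]; exact h.Fcomm x y
    have αc := h.αcomm hF x y
    refine h.M_ss (pH p s.hom).ker (Subgroup.zpowers ⁅x, y⁆) F ?_ ?_ ?_ ?_ ?_ ?_ ?_ ?_ ?_ ?_
    · rw [Subgroup.zpowers_le, Subgroup.mem_comap, αc]
      exact Subgroup.zpow_mem _ (Subgroup.mem_zpowers _) _
    · intro ht
      apply hz
      rw [← mem_pH (h := s.hom), ht]; trivial
    · intro x hx
      rw [mem_pH] at *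
      rw [← map_pow, hx, map_one]
    · intro f hf; rw [mem_pH]; exact s.Fea.2 f (hcF hf)
    · intro a _ b _
      obtain ⟨w, hw, i, e⟩ := s.gen _ (h.Fcomm a b)
      have e2 := h.αcomm hF a b
      have cc : Commute w (⁅x, y⁆ ^ i) := cen_comm (s.Zc hw) _
      rw [e, cc.mul_zpow, map_mul, map_zpow, αc, αZ w hw, ← zpow_mul, ← zpow_mul, mul_comm i] at e2
      have w1 := zpow_ne h.hp (Zp w hw) (mul_right_cancel e2).symm h.kk1
      rw [e, w1, one_mul]
      exact Subgroup.zpow_mem _ (Subgroup.mem_zpowers _) _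
    · intro a ha; rw [mem_pH] at ha; rw [ha]; exact Subgroup.one_mem _
    · have hFact : Fact p.Prime := ⟨h.hp⟩
      rw [Nat.card_zpowers, orderOf_eq_prime (s.Fea.2 _ (h.Fcomm x y))
        (fun h0 => s.cnZ (by rw [h0]; exact Z.one_mem)), ← pow_succ]
      exact s.card_ker p0 (pH p s.hom) s.pw
    · intro f hf; rw [mem_pH]; exact s.Fea.2 f hf
    · intro x hx; exact h.sc x
    · intro d hd
      obtain ⟨w, hw, i, rfl⟩ := s.gen d hd
      have cc : Commute w (⁅x, y⁆ ^ i) := cen_comm (s.Zc hw) _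
      rw [cc.mul_zpow, map_mul, map_zpow, αc, αZ w hw, ← zpow_mul, ← zpow_mul, mul_inv_rev]
      have e : ∀ a b c : P, a * b * (c * a⁻¹) = a * (b * c) * a⁻¹ := by
        intro a b c; group
      rw [e]
      exact this.conj_mem _ (Subgroup.mul_mem _ (Subgroup.zpow_mem _ (Subgroup.mem_zpowers _) _)
        (Subgroup.inv_mem _ (Subgroup.zpow_mem _ (Subgroup.mem_zpowers _) _))) _
end MP


namespace MP
open scoped commutatorElement

variable {p q : ℕ} {k : ℤ} {P : Type*} [Group P] {α : P →* P} {F Z : Subgroup P} {x y z : P}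

lemma inv_ext {A : Subgroup P} {u b : P} (hA : ∀ a ∈ A, α a = a⁻¹) (hu : α u = u⁻¹)
    (hc : ∀ a ∈ A, Commute a u) (hb : ∃ a ∈ A, ∃ i : ℤ, b = a * u ^ i) : α b = b⁻¹ := by
  obtain ⟨a, ha, i, rfl⟩ := hb
  rw [map_mul, map_zpow, hA a ha, hu, mul_inv_rev, inv_zpow]
  exact (((hc a ha).zpow_right i).inv_left.inv_right).eq

lemma GP.αgc (h : GP p q k P α F) (s : Q5 p q k P α F Z x y z) (g : P) :
    α ⁅g, ⁅x, y⁆⁆ = ⁅g, ⁅x, y⁆⁆ ^ (k * (k * k)) := by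
  obtain ⟨f, hf, e⟩ := h.scx g
  obtain ⟨w, hw, e'⟩ := s.Fk _ (h.Fcomm x y)
  rw [map_commutatorElement α g, e, e']
  exact comm_eig (s.Zc (comm_swap_mem (s.Fg _ (h.Fcomm x y) g))) _ _
    (s.Fea.1 _ hf _ (h.Fcomm x y)) (s.Fea.1 _ hf _ (s.ZF hw)) (cen_comm (s.Zc hw) _).symm

lemma Q5.mod_z (h : GP p q k P α F) (s : Q5 p q k P α F Z x y z) {y0 : P}
    (hy0 : ⁅⁅x, y⁆, y0⁆ ≠ 1) : ∃ z', Q5 p q k P α F Z x y z' ∧ ⁅z', y0⁆ = 1 := by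
  have hcF := h.Fcomm x y
  have hcg : ∀ g : P, ⁅⁅x, y⁆, g⁆ ∈ Z := fun g => s.Fg _ hcF g
  obtain ⟨i, hi⟩ := gen_of_card h.hp s.cZ (hcg y0) hy0 (s.zZ y0)
  have e : ∀ g : P, ⁅⁅x, y⁆ ^ (-i) * z, g⁆ = ⁅⁅x, y⁆, g⁆ ^ (-i) * ⁅z, g⁆ := by
    intro g
    rw [comm_mul_left (s.Zc (s.zZ g))]
    have := comm_zpow (s.Zc (hcg g)) (-i) 1
    rw [zpow_one, mul_one] at this
    rw [this]
  refine ⟨⁅x, y⁆ ^ (-i) * z, ⟨s.ZF, s.Zc, s.cZ, s.Zα, s.cP, s.cF, s.pw, s.Fg, s.Fk, s.cnZ, ?_, ?_,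
    s.gen, s.Fea, ?_, s.hom⟩, ?_⟩
  · intro g
    rw [e]; exact Z.mul_mem (Z.zpow_mem (hcg g) _) (s.zZ g)
  · intro hm
    rw [F.mul_mem_cancel_left (F.zpow_mem hcF _)] at hm
    exact s.zF hm
  · intro f hf
    exact (s.Fea.1 _ hf _ (F.zpow_mem hcF _)).mul_right (s.zcF f hf)
  · rw [e, hi, zpow_neg, inv_mul_cancel]

lemma GP.z_cen (h : GP p q k P α F) (s : Q5 p q k P α F Z x y z) {y0 : P}
    (hy0 : ⁅⁅x, y⁆, y0⁆ ≠ 1) (hz : ⁅z, y0⁆ = 1) : z ∈ Subgroup.center P := by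
  have hcF := h.Fcomm x y
  have hcg : ∀ g : P, ⁅⁅x, y⁆, g⁆ ∈ Z := fun g => s.Fg _ hcF g
  have Zp : ∀ w ∈ Z, w ^ p = 1 := fun w hw => s.Fea.2 w (s.ZF hw)
  have αZ : ∀ w ∈ Z, α w = w ^ (k * (k * k)) := by
    refine eig_all h.hp s.cZ (comm_swap_mem (hcg y0)) ?_ (h.αgc s y0)
    rwa [← commutatorElement_inv, inv_ne_one]
  rw [commutatorElement_eq_one_iff_commute] at hz
  obtain ⟨t, ht, et⟩ := h.scx z
  obtain ⟨f, hf, ef⟩ := h.scx y0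
  have htZ : t ∈ Z := by
    have c1 : Commute (z ^ k * t) (y0 ^ k * f) := by
      rw [← et, ← ef]; exact hz.map α
    have c2 : Commute (z ^ k) (y0 ^ k * f) :=
      ((hz.zpow_right k).mul_right (s.zcF f hf).symm).zpow_left k
    have c3 : Commute t (y0 ^ k * f) := by
      have := c2.inv_left.mul_left c1
      rwa [inv_mul_cancel_left] at this
    have c4 : Commute t (y0 ^ k) := by
      have := c3.mul_right (s.Fea.1 _ ht _ hf).inv_right
      rwa [mul_inv_cancel_right] at this
    have c5 := comm_zpow (s.Zc (s.Fg t ht y0)) 1 k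
    rw [zpow_one, commutatorElement_eq_one_iff_commute.2 c4, one_mul] at c5
    have c6 : ⁅t, y0⁆ = 1 := zpow_eq_one_of h.hp (Zp _ (s.Fg t ht y0)) c5.symm h.pk
    obtain ⟨w, hw, i, rfl⟩ := s.gen t ht
    have c7 : Commute (⁅x, y⁆ ^ i) y0 := by
      have := (cen_comm (s.Zc hw) y0).inv_left.mul_left (commutatorElement_eq_one_iff_commute.1 c6)
      rwa [inv_mul_cancel_left] at this
    have c8 := comm_zpow (s.Zc (s.Fg _ hcF y0)) i 1
    rw [zpow_one, commutatorElement_eq_one_iff_commute.2 c7, mul_one] at c8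
    have hpi : (p : ℤ) ∣ i := by
      by_contra hpi
      exact hy0 (zpow_eq_one_of h.hp (Zp _ (hcg y0)) c8.symm hpi)
    have := zpow_eq_of_dvd (s.Fea.2 _ hcF) (i := i) (j := 0) (by simpa using hpi)
    rw [this, zpow_zero, mul_one]; exact hw
  rw [Subgroup.mem_center_iff]
  intro g
  suffices ⁅z, g⁆ = 1 from ((commutatorElement_eq_one_iff_commute.1 this).eq).symm
  obtain ⟨f', hf', ef'⟩ := h.scx g
  have e1 : α ⁅z, g⁆ = ⁅z, g⁆ ^ (k * k) := by
    rw [map_commutatorElement, et, ef']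
    exact comm_eig (s.Zc (s.zZ g)) _ _ (cen_comm (s.Zc htZ) _) (cen_comm (s.Zc htZ) _) (s.zcF f' hf').symm
  have e2 := αZ _ (s.zZ g)
  refine zpow_ne h.hp (Zp _ (s.zZ g)) (e2.symm.trans e1) ?_
  have : k * (k * k) - k * k = k * (k * k - k) := by ring
  rw [this]
  intro hd
  rcases h.pp.dvd_or_dvd hd with h1 | h1
  · exact h.pk h1
  · exact h.kk1 h1

lemma GP.q2 (h : GP p q k P α F) (hk : (p : ℤ) ∣ k + 1) : q = 2 := by
  rcases h.hq.eq_two_or_odd' with h1 | h1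
  · exact h1
  · exfalso
    have h2 : k + 1 ∣ k ^ q + 1 ^ q := h1.add_dvd_pow_add_pow k 1
    rw [one_pow] at h2
    have h3 := dvd_sub (hk.trans h2) h.kq
    have h4 : k ^ q + 1 - (k ^ q - 1) = 2 := by ring
    rw [h4] at h3
    have h5 := Int.le_of_dvd (by norm_num) h3
    have := h.h3
    omega

lemma GP.αα (h : GP p q k P α F) (hk : (p : ℤ) ∣ k + 1) (x : P) : α (α x) = x := by
  have := h.αq x
  rw [h.q2 hk] at this
  exact this

lemma GP.inv_of (h : GP p q k P α F) (hk : (p : ℤ) ∣ k + 1) (x : P) :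
    α (x * (α x)⁻¹) = (x * (α x)⁻¹)⁻¹ := by
  rw [map_mul, map_inv, h.αα hk, mul_inv_rev, inv_inv]

lemma L5 (h : GP p q k P α F) (hc : Nat.card P = p ^ 5) : (p : ℤ) ∣ k + 1 ∧
    ∃ Z x y z, Q5 p q k P α F Z x y z ∧ z ∈ Subgroup.center P ∧ z ^ p ≠ 1 ∧
    ∃ y0 : P, ⁅⁅x, y⁆, y0⁆ ≠ 1 := by
  have := h.fin
  have p0 := h.hp.pos
  have p1 := h.hp.one_lt
  obtain ⟨Z, x, y, z, s⟩ := h.q5 hc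
  have hcF := h.Fcomm x y
  have hcg : ∀ g : P, ⁅⁅x, y⁆, g⁆ ∈ Z := fun g => s.Fg _ hcF g
  have hgc : ∀ g : P, ⁅g, ⁅x, y⁆⁆ ∈ Z := fun g => comm_swap_mem (hcg g)
  obtain ⟨y0, hy0⟩ : ∃ y0 : P, ⁅⁅x, y⁆, y0⁆ ≠ 1 := by
    by_contra hne
    push Not at hne
    refine h.caseI s ?_
    rw [Subgroup.mem_center_iff]
    intro g
    exact (commutatorElement_eq_one_iff_commute.1 (hne g)).eq.symm
  obtain ⟨z, s, hzy⟩ := s.mod_z h hy0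
  have hz := h.z_cen s hy0 hzy
  have Zp : ∀ w ∈ Z, w ^ p = 1 := fun w hw => s.Fea.2 w (s.ZF hw)
  have αZ : ∀ w ∈ Z, α w = w ^ (k * (k * k)) := by
    refine eig_all h.hp s.cZ (comm_swap_mem (hcg y0)) ?_ (h.αgc s y0)
    rwa [← commutatorElement_inv, inv_ne_one]
  -- commuting with `⟨F, z⟩`
  have key : ∀ t : P, Commute t ⁅x, y⁆ → ∀ a : P, (∃ f ∈ F, ∃ i : ℤ, a = f * z ^ i) →
      Commute a t := by
    rintro t ht a ⟨f, hf, i, rfl⟩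
    refine Commute.mul_left ?_ ((cen_comm hz t).zpow_left i)
    obtain ⟨w, hw, j, rfl⟩ := s.gen f hf
    exact (cen_comm (s.Zc hw) t).mul_left (ht.symm.zpow_left j)
  have hk : (p : ℤ) ∣ k + 1 := by
    by_contra hk
    have hk3 : ¬ (p : ℤ) ∣ k * (k * k) - k := by
      have : k * (k * k) - k = (k * k - k) * (k + 1) := by ring
      rw [this]
      intro hd
      rcases h.pp.dvd_or_dvd hd with h1 | h1
      · exact h.kk1 h1
      · exact hk h1
    have ex : ∀ a : P, a ^ p = 1 := fun a =>
      zpow_ne h.hp (Zp _ (s.pw a)) ((αZ _ (s.pw a)).symm.trans (h.αp s a)) hk3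
    obtain ⟨A, h1, h2, h3⟩ := h.Fz s (ex z)
    refine h.E_contr h1 h2 (s.card_ker p0 (cH _ (fun g => s.Zc (hgc g))) hgc) (fun t _ => ex t) ?_
    intro t ht a ha
    rw [mem_cH] at ht
    exact key t ht a (h3 a ha)
  refine ⟨hk, Z, x, y, z, s, hz, ?_, y0, hy0⟩
  intro hzp
  obtain ⟨u, hu, huc⟩ : ∃ u : P, u ^ p = 1 ∧ ¬ Commute u ⁅x, y⁆ := by
    by_contra hne
    push Not at hne
    obtain ⟨A, h1, h2, h3⟩ := h.Fz s hzp
    refine h.E_contr h1 h2 (s.card_ker p0 (pH p s.hom) s.pw) (fun t ht => mem_pH.1 ht) ?_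
    intro t ht a ha
    rw [mem_pH] at ht
    exact key t (hne t ht) a (h3 a ha)
  -- the inverted elements
  set z' := z * (α z)⁻¹ with hz'
  set u' := u * (α u)⁻¹ with hu'
  have αz' : α z' = z'⁻¹ := h.inv_of hk z
  have αu' : α u' = u'⁻¹ := h.inv_of hk u
  have nk : ¬ (p : ℤ) ∣ 1 - k := by
    intro hd; apply h.hk; rw [← neg_sub]; exact (dvd_neg).2 hd
  have z'F : z' ∉ F := by
    intro hm
    obtain ⟨f, hf, e⟩ := h.scx z
    rw [hz', e, mul_inv_rev, ← mul_assoc] at hm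
    have e3 : z * f⁻¹ = f⁻¹ * z := (s.zcF f hf).inv_left.eq.symm
    rw [e3, mul_assoc, F.mul_mem_cancel_left (F.inv_mem hf), ← zpow_neg, ← zpow_one_add] at hm
    exact s.zF (zpow_mem_of h.hp (h.Fpow z) hm (by simpa [sub_eq_add_neg] using nk))
  have z'c : z' ∈ Subgroup.center P := by
    refine Subgroup.mul_mem _ hz (Subgroup.inv_mem _ ?_)
    rw [Subgroup.mem_center_iff]
    intro g
    rw [← h.αα hk g, ← map_mul, ← map_mul, (cen_comm hz _).eq]
  have z'p : z' ^ p = 1 := by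
    rw [hz', s.hom, hzp, one_mul, inv_pow, ← map_pow, hzp, map_one, inv_one]
  have u'p : u' ^ p = 1 := by
    rw [hu', s.hom, hu, one_mul, inv_pow, ← map_pow, hu, map_one, inv_one]
  have u'c : ¬ Commute u' ⁅x, y⁆ := by
    intro hm
    rw [← mem_cH (hb := fun g => s.Zc (hgc g)), MonoidHom.mem_ker] at hm
    obtain ⟨f, hf, e⟩ := h.scx u
    have hf1 : cH ⁅x, y⁆ (fun g => s.Zc (hgc g)) f = 1 := by
      rw [← MonoidHom.mem_ker, mem_cH]; exact s.Fea.1 _ hf _ hcF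
    rw [hu', e, map_mul, map_inv, map_mul, hf1, mul_one, map_zpow, ← zpow_neg, ← zpow_one_add] at hm
    apply huc
    rw [← mem_cH (hb := fun g => s.Zc (hgc g)), MonoidHom.mem_ker]
    exact zpow_eq_one_of h.hp (Zp _ (hgc u)) hm (by simpa [sub_eq_add_neg] using nk)
  have Zea : EA p Z := ⟨fun a ha b _ => cen_comm (s.Zc ha) b, Zp⟩
  obtain ⟨A, hA, ZA, zA, genA⟩ := EA_ext Zea (fun a ha => cen_comm (s.Zc ha) z') z'p
  have Ac : ∀ a ∈ A, a ∈ Subgroup.center P := by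
    intro a ha
    obtain ⟨w, hw, i, rfl⟩ := genA a ha
    exact Subgroup.mul_mem _ (s.Zc hw) (Subgroup.zpow_mem _ z'c i)
  obtain ⟨B, hB, AB, uB, genB⟩ := EA_ext hA (fun a ha => cen_comm (Ac a ha) u') u'p
  have dk : (p : ℤ) ∣ k * (k * k) - (-1) := by
    have : k * (k * k) - (-1) = (k + 1) * (k * k - k + 1) := by ring
    rw [this]; exact hk.mul_right _
  have αB : ∀ b ∈ B, α b = b⁻¹ := by
    intro b hb
    refine inv_ext ?_ αu' (fun a ha => cen_comm (Ac a ha) u') (genB b hb)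
    intro a ha
    refine inv_ext ?_ αz' (fun a ha => cen_comm (s.Zc ha) z') (genA a ha)
    intro w hw
    rw [αZ w hw, zpow_eq_of_dvd (Zp w hw) dk, zpow_neg_one]
  refine h.M B ⊥ ?_ ?_ bot_le ?_ ?_ ?_ ?_
  · rintro rfl
    apply h.R4 hB
    rw [Subgroup.card_top, hc]
    exact Nat.pow_le_pow_right p0 (by norm_num)
  · intro b hb; rw [αB b hb]; exact B.inv_mem hb
  · intro a ha b hb
    rw [Subgroup.mem_bot, commutatorElement_eq_one_iff_commute]; exact hB.1 a ha b hb
  · intro a ha; rw [Subgroup.mem_bot]; exact hB.2 a ha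
  · have h1 := card_lt h.hp h.pg ZA zA (fun hm => z'F (s.ZF hm))
    have h2 := card_lt h.hp h.pg AB uB (fun hm => u'c (cen_comm (Ac _ hm) _))
    rw [s.cZ] at h1
    rw [Subgroup.card_bot, mul_one]
    calc p ^ 3 = p * (p * p) := by ring
      _ ≤ p * Nat.card A := Nat.mul_le_mul_left _ h1
      _ ≤ _ := h2
  · intro b hb
    rw [αB b hb, ← zpow_neg_one, zpow_eq_of_dvd (hB.2 b hb) (i := k) (j := -1) (by simpa using hk),
      mul_inv_cancel]
    exact Subgroup.one_mem _

end MP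


namespace MP
open scoped commutatorElement

variable {p q : ℕ} {k : ℤ} {P : Type*} [Group P] {α : P →* P} {F Y N : Subgroup P} {x y z : P}

lemma ab_ext {A B : Subgroup P} {u : P} (hA : ∀ a ∈ A, ∀ b ∈ A, Commute a b)
    (h : ∀ a ∈ A, Commute a u) (h3 : ∀ g ∈ B, ∃ a ∈ A, ∃ i : ℤ, g = a * u ^ i) :
    ∀ a ∈ B, ∀ b ∈ B, Commute a b := by
  intro x hx y hy
  obtain ⟨a, ha, i, rfl⟩ := h3 x hx
  obtain ⟨b, hb, j, rfl⟩ := h3 y hy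
  apply Commute.mul_left
  · exact (hA a ha b hb).mul_right ((h a ha).zpow_right j)
  · exact (((h b hb).symm.zpow_left i)).mul_right (((Commute.refl u).zpow_left i).zpow_right j)

lemma GP.inv_notin (h : GP p q k P α F) (hx : x ∉ F) : x * (α x)⁻¹ ∉ F := by
  intro hm
  obtain ⟨f, hf, e⟩ := h.scx x
  have nk : ¬ (p : ℤ) ∣ 1 - k := by
    intro hd; apply h.hk; rw [← neg_sub]; exact (dvd_neg).2 hd
  have e1 : x * (α x)⁻¹ = (x * f⁻¹ * x⁻¹) * x ^ (1 - k) := by rw [e]; group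
  rw [e1, F.mul_mem_cancel_left (h.Fn.conj_mem _ (F.inv_mem hf) _)] at hm
  exact hx (zpow_mem_of h.hp (h.Fpow x) hm nk)

/-- working data in order `p^6` -/
structure Q6 (p q : ℕ) (k : ℤ) (P : Type*) [Group P] (α : P →* P) (F Y N : Subgroup P)
    (x y z : P) : Prop where
  hk : (p : ℤ) ∣ k + 1
  cP : Nat.card P = p ^ 6
  cY : Nat.card Y = p
  cN : Nat.card N = p ^ 2
  cF : Nat.card F = p ^ 3
  YN : Y ≤ N
  NF : N ≤ F
  Yα : Y ≤ Y.comap α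
  Nc : N ≤ Subgroup.center P
  Nea : EA p N
  Fea : EA p F
  pw : ∀ g : P, g ^ p ∈ N
  Fg : ∀ f ∈ F, ∀ g : P, ⁅f, g⁆ ∈ N
  zZ : ∀ g : P, ⁅z, g⁆ ∈ Y
  zp : z ^ p ∉ Y
  c1 : ⁅x, y⁆ ≠ 1
  genN : ∀ n ∈ N, ∃ w ∈ Y, ∃ i : ℤ, n = w * (z ^ p) ^ i
  gen : ∀ f ∈ F, ∃ w ∈ N, ∃ i : ℤ, f = w * ⁅x, y⁆ ^ i
  hom : ∀ a b : P, (a * b) ^ p = a ^ p * b ^ p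
  αc : ∀ g : P, α ⁅g, ⁅x, y⁆⁆ = ⁅g, ⁅x, y⁆⁆⁻¹

lemma ext_eq (hp : p.Prime) [Finite P] (hG : IsPGroup p P) {A B : Subgroup P} (hAB : A ≤ B)
    {u : P} (hu : u ∈ B) (hu' : u ∉ A) (h : ∀ a ∈ A, Commute a u)
    (hc : Nat.card B ≤ p * Nat.card A) : ∀ g ∈ B, ∃ a ∈ A, ∃ i : ℤ, g = a * u ^ i := by
  obtain ⟨C, h1, h2, h3⟩ := exists_ext A u h
  have CB : C ≤ B := by
    intro c hc
    obtain ⟨a, ha, i, rfl⟩ := h3 c hc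
    exact B.mul_mem (hAB ha) (B.zpow_mem hu i)
  have : C = B := Subgroup.eq_of_le_of_card_ge CB (hc.trans (card_lt hp hG h1 h2 hu'))
  rwa [this] at h3

lemma GP.q6 (h : GP p q k P α F) (hc : Nat.card P = p ^ 6) :
    ∃ Y N x y z, Q6 p q k P α F Y N x y z := by
  have := h.fin
  have p0 := h.hp.pos
  have p1 := h.hp.one_lt
  have cF : Nat.card F = p ^ 3 := h.card_F hc
  obtain ⟨Y, YF, Yc, cY, Yα⟩ := h.red (by
      rintro rfl
      rw [Subgroup.card_bot] at cF
      have : 1 < p ^ 3 := Nat.one_lt_pow (by norm_num) p1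
      omega)
  have := normal_of_center Yc
  obtain ⟨hk, Zb, x, y, z, s, hz, hzp, y0, hy0⟩ := L5 (h.quot Y Yα YF) (card_quot p0 hc cY)
  induction x using QuotientGroup.induction_on with | H x =>
  induction y using QuotientGroup.induction_on with | H y =>
  induction z using QuotientGroup.induction_on with | H z =>
  induction y0 using QuotientGroup.induction_on with | H y0 =>
  obtain ⟨N, hN⟩ : ∃ N, N = Zb.comap (QuotientGroup.mk' Y) := ⟨_, rfl⟩
  have memN : ∀ g : P, g ∈ N ↔ (g : P ⧸ Y) ∈ Zb := by intro g; rw [hN]; rfl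
  have cN : Nat.card N = p ^ 2 := by rw [hN, card_comap_mk, cY, s.cZ, pow_two]
  have YN : Y ≤ N := by
    intro w hw; rw [memN, (QuotientGroup.eq_one_iff w).2 hw]; exact Zb.one_mem
  have NF : N ≤ F := by
    intro n hn; rw [memN] at hn
    exact (mk_mem_map YF).1 (s.ZF hn)
  have pw : ∀ g : P, g ^ p ∈ N := fun g => (memN _).2 (s.pw g)
  have Fg : ∀ f ∈ F, ∀ g : P, ⁅f, g⁆ ∈ N := fun f hf g => (memN _).2 (s.Fg f ⟨f, hf, rfl⟩ g)
  have zZ := mk_mem_center.1 hz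
  have zp : z ^ p ∉ Y := by rw [← QuotientGroup.eq_one_iff]; exact hzp
  have cnN : ⁅x, y⁆ ∉ N := by rw [memN]; exact s.cnZ
  have cy0 : ⁅⁅x, y⁆, y0⁆ ∉ Y := by rw [← QuotientGroup.eq_one_iff]; exact hy0
  have Yp : ∀ w ∈ Y, w ^ p = 1 := fun w hw => pow_card_one cY hw
  have zpc : z ^ p ∈ Subgroup.center P := by
    rw [Subgroup.mem_center_iff]
    intro g
    have := comm_zpow (Yc (zZ g)) p 1
    rw [zpow_one, mul_one, zpow_natCast, zpow_natCast, Yp _ (zZ g),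
      commutatorElement_eq_one_iff_mul_comm] at this
    exact this.symm
  have cNY : Nat.card N ≤ p * Nat.card Y := by rw [cN, cY, pow_two]
  have genN := ext_eq h.hp h.pg YN (pw z) zp (fun a ha => cen_comm (Yc ha) _) cNY
  have Nc : N ≤ Subgroup.center P := by
    intro n hn
    obtain ⟨w, hw, i, rfl⟩ := genN n hn
    exact Subgroup.mul_mem _ (Yc hw) (Subgroup.zpow_mem _ zpc i)
  obtain ⟨e1, e2, hom⟩ := pow_hom h.hp h.h3 (fun g => Nc (pw g))
    (fun a b g => Nc (Fg _ (h.Fcomm _ _) g))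
  have genN' := ext_eq h.hp h.pg YN (Fg _ (h.Fcomm x y) y0) cy0
    (fun a ha => cen_comm (Yc ha) _) cNY
  have Nea : EA p N := by
    refine ⟨fun a ha b _ => cen_comm (Nc ha) b, ?_⟩
    intro n hn
    obtain ⟨w, hw, i, rfl⟩ := genN' n hn
    rw [hom, Yp w hw, one_mul, ← zpow_natCast, ← zpow_mul, mul_comm, zpow_mul,
      zpow_natCast, e2, one_zpow]
  have gen := ext_eq h.hp h.pg NF (h.Fcomm x y) cnN (fun a ha => cen_comm (Nc ha) _)
    (by rw [cF, cN]; apply le_of_eq; ring)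
  have Fea : EA p F := by
    refine ⟨ab_ext Nea.1 (fun a ha => cen_comm (Nc ha) _) gen, ?_⟩
    intro n hn
    obtain ⟨w, hw, i, rfl⟩ := gen n hn
    rw [hom, Nea.2 w hw, one_mul, ← zpow_natCast, ← zpow_mul, mul_comm, zpow_mul,
      zpow_natCast, e1, one_zpow]
  refine ⟨Y, N, x, y, z, hk, hc, cY, cN, cF, YN, NF, Yα, Nc, Nea, Fea, pw, Fg, zZ, zp, ?_,
    genN, gen, hom, ?_⟩
  · intro h0; rw [h0] at cnN; exact cnN N.one_mem
  · intro g
    obtain ⟨f, hf, e⟩ := h.scx g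
    obtain ⟨w, hw, e'⟩ := s.Fk (⁅x, y⁆ : P) ⟨_, h.Fcomm x y, rfl⟩
    have hcF := h.Fcomm x y
    obtain ⟨w, hw, e'⟩ : ∃ w ∈ N, α ⁅x, y⁆ = ⁅x, y⁆ ^ (k * k) * w := by
      refine ⟨(⁅x, y⁆ ^ (k * k))⁻¹ * α ⁅x, y⁆, ?_, by group⟩
      rw [memN, QuotientGroup.mk_mul, QuotientGroup.mk_inv]
      have e'' : ((α ⁅x, y⁆ : P) : P ⧸ Y) = (⁅x, y⁆ : P) ^ (k * k) * w := e'
      rw [e'', QuotientGroup.mk_zpow, inv_mul_cancel_left]; exact hw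
    have hgc := comm_swap_mem (Fg _ hcF g)
    rw [map_commutatorElement α g, e, e', comm_eig (Nc hgc) _ _
      (Fea.1 _ hf _ hcF) (Fea.1 _ hf _ (NF hw)) (cen_comm (Nc hw) _).symm, ← zpow_neg_one]
    refine zpow_eq_of_dvd (Nea.2 _ hgc) ?_
    have : k * (k * k) - (-1) = (k + 1) * (k * k - k + 1) := by ring
    rw [this]; exact hk.mul_right _

lemma Q6.αp (h : GP p q k P α F) (s : Q6 p q k P α F Y N x y z) (a : P) :
    α (a ^ p) = (a ^ p)⁻¹ := by
  obtain ⟨f, hf, e⟩ := h.scx a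
  rw [comm_exp s.hom ⟨f, e, s.Fea.2 f hf⟩, ← zpow_neg_one]
  exact zpow_eq_of_dvd (s.Nea.2 _ (s.pw a)) (by simpa using s.hk)

lemma Q6.case1 (h : GP p q k P α F) (s : Q6 p q k P α F Y N x y z)
    (hY : ∀ w ∈ Y, α w = w⁻¹) : False := by
  have := h.fin
  have p0 := h.hp.pos
  have p1 := h.hp.one_lt
  have hFact : Fact p.Prime := ⟨h.hp⟩
  have Yc := s.YN.trans s.Nc
  have := normal_of_center Yc
  have p2 : ¬ (p : ℤ) ∣ 2 := by
    intro hd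
    have h5 := Int.le_of_dvd (by norm_num) hd
    have := h.h3
    omega
  have αN : ∀ n ∈ N, α n = n⁻¹ := fun n hn =>
    inv_ext hY (s.αp h z) (fun a ha => cen_comm (Yc ha) _) (s.genN n hn)
  obtain ⟨v, hv, hvF⟩ : ∃ v ∈ (pH p s.hom).ker, v ∉ F := by
    apply exists_of_card_lt
    have := card_ker_le (pH p s.hom) N (fun g => s.pw g)
    rw [s.cP, s.cN] at this
    have h4 : p ^ 4 ≤ Nat.card (pH p s.hom).ker := by
      refine Nat.le_of_mul_le_mul_left (c := p ^ 2) ?_ (by positivity)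
      calc _ = p ^ 6 := by ring
        _ ≤ _ := this
    rw [s.cF]
    exact lt_of_lt_of_le (Nat.pow_lt_pow_right p1 (by norm_num)) h4
  rw [mem_pH] at hv
  set z' := z * (α z)⁻¹ with hz'
  set v' := v * (α v)⁻¹ with hv'
  have αz' : α z' = z'⁻¹ := h.inv_of s.hk z
  have αv' : α v' = v'⁻¹ := h.inv_of s.hk v
  have v'p : v' ^ p = 1 := by
    rw [hv', s.hom, hv, one_mul, inv_pow, ← map_pow, hv, map_one, inv_one]
  have z'p : z' ^ p ≠ 1 := by
    intro h0
    rw [hz', s.hom, inv_pow, ← map_pow, s.αp h, inv_inv] at h0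
    apply s.zp
    have : (z ^ p) ^ (2 : ℤ) = 1 := by rw [zpow_two]; exact h0
    rw [zpow_eq_one_of h.hp (s.Nea.2 _ (s.pw z)) this p2]
    exact Y.one_mem
  have z'Y : ∀ g : P, ⁅z', g⁆ ∈ Y := by
    rw [← mk_mem_center]
    refine Subgroup.mul_mem _ (mk_mem_center.2 s.zZ) (Subgroup.inv_mem _ (mk_mem_center.2 ?_))
    intro u
    rw [← h.αα s.hk u, ← map_commutatorElement]
    exact s.Yα (s.zZ _)
  have czv : Commute z' v' := by
    have hy := z'Y v'
    have e1 : α ⁅z', v'⁆ = ⁅z', v'⁆ := by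
      rw [map_commutatorElement, αz', αv', ← zpow_neg_one, ← zpow_neg_one, comm_zpow (Yc hy)]
      norm_num
    rw [hY _ hy] at e1
    rw [← commutatorElement_eq_one_iff_commute]
    refine zpow_ne h.hp (pow_card_one s.cY hy) (i := 1) (j := -1) ?_ (by norm_num; exact p2)
    rw [zpow_one, zpow_neg_one, e1]
  obtain ⟨A, NA, zA, genA⟩ := exists_ext N z' (fun a ha => cen_comm (s.Nc ha) z')
  have Acomm := ab_ext s.Nea.1 (fun a ha => cen_comm (s.Nc ha) z') genA
  have Av : ∀ a ∈ A, Commute a v' := by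
    intro a ha
    obtain ⟨w, hw, i, rfl⟩ := genA a ha
    exact (cen_comm (s.Nc hw) _).mul_left (czv.zpow_left i)
  obtain ⟨B, AB, vB, genB⟩ := exists_ext A v' Av
  have Bcomm := ab_ext Acomm Av genB
  have z'N : z' ∉ N := fun hm => z'p (s.Nea.2 _ hm)
  have v'A : v' ∉ A := by
    intro hm
    obtain ⟨w, hw, i, e⟩ := genA _ hm
    have e2 := v'p
    rw [e, s.hom, s.Nea.2 w hw, one_mul, ← zpow_natCast, ← zpow_mul, mul_comm, zpow_mul,
      zpow_natCast] at e2
    have hpi : (p : ℤ) ∣ i := by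
      by_contra hpi
      exact z'p (zpow_eq_one_of h.hp (s.Nea.2 _ (s.pw z')) e2 hpi)
    have : v' ∈ N := by
      rw [e]; exact N.mul_mem hw (zpow_mem_of_dvd (s.pw z') hpi)
    exact h.inv_notin hvF (s.NF this)
  have Bp : ∀ a ∈ B, a ^ p ∈ Subgroup.zpowers (z' ^ p) := by
    intro b hb
    obtain ⟨a, ha, i, rfl⟩ := genB b hb
    obtain ⟨w, hw, j, rfl⟩ := genA a ha
    have e : ∀ (g : P) (i : ℤ), (g ^ i) ^ p = (g ^ p) ^ i := by
      intro g i
      rw [← zpow_natCast, ← zpow_natCast, ← zpow_mul, ← zpow_mul, mul_comm]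
    rw [s.hom (w * z' ^ j) (v' ^ i), s.hom w (z' ^ j), s.Nea.2 w hw, one_mul, e, e, v'p, one_zpow, mul_one]
    exact Subgroup.zpow_mem _ (Subgroup.mem_zpowers _) _
  have αB : ∀ b ∈ B, α b = b⁻¹ := by
    intro b hb
    refine inv_ext ?_ αv' Av (genB b hb)
    intro a ha
    exact inv_ext αN αz' (fun a ha => cen_comm (s.Nc ha) z') (genA a ha)
  refine h.M B (Subgroup.zpowers (z' ^ p)) ?_ ?_ ?_ ?_ Bp ?_ ?_
  · rintro rfl
    exact s.c1 (commutatorElement_eq_one_iff_commute.2 (Bcomm x trivial y trivial))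
  · intro b hb; rw [αB b hb]; exact B.inv_mem hb
  · rw [Subgroup.zpowers_le]; exact B.pow_mem (AB zA) p
  · intro a ha b hb
    rw [commutatorElement_eq_one_iff_commute.2 (Bcomm a ha b hb)]; exact Subgroup.one_mem _
  · rw [Nat.card_zpowers, orderOf_eq_prime (s.Nea.2 _ (s.pw z')) z'p]
    have h1 := card_lt h.hp h.pg NA zA z'N
    have h2 := card_lt h.hp h.pg AB vB v'A
    rw [s.cN] at h1
    calc p ^ 3 * p = p * (p * p ^ 2) := by ring
      _ ≤ p * Nat.card A := Nat.mul_le_mul_left _ h1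
      _ ≤ _ := h2
  · intro b hb
    have : α b * (b ^ k)⁻¹ = b ^ (-(k + 1)) := by
      rw [αB b hb]; group
    rw [this]
    exact zpow_mem_of_dvd (Bp b hb) ((dvd_neg).2 s.hk)

lemma L6 (h : GP p q k P α F) (hc : Nat.card P = p ^ 6) : False := by
  have := h.fin
  have p0 := h.hp.pos
  have p1 := h.hp.one_lt
  obtain ⟨Y, N, x, y, z, s⟩ := h.q6 hc
  have Yc := s.YN.trans s.Nc
  have := normal_of_center Yc
  by_cases hY : ∀ w ∈ Y, α w = w⁻¹
  · exact s.case1 h hY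
  have hY1 : ∀ w ∈ Y, α w = w⁻¹ → w = 1 := by
    intro w hw e
    by_contra w1
    apply hY
    intro v hv
    rw [← zpow_neg_one]
    exact eig_all h.hp s.cY hw w1 (by rw [e, zpow_neg_one]) v hv
  have hgc : ∀ g : P, ⁅g, ⁅x, y⁆⁆ ∈ N := fun g => comm_swap_mem (s.Fg _ (h.Fcomm x y) g)
  let φ := (QuotientGroup.mk' Y).comp (pH p s.hom)
  let ψ := (QuotientGroup.mk' Y).comp (cH ⁅x, y⁆ (fun g => s.Nc (hgc g)))
  have cM : Nat.card (N.map (QuotientGroup.mk' Y)) = p := by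
    have := card_comap_mk Y (N.map (QuotientGroup.mk' Y))
    rw [Subgroup.comap_map_eq, QuotientGroup.ker_mk', sup_eq_left.2 s.YN, s.cN, s.cY, pow_two] at this
    exact (Nat.eq_of_mul_eq_mul_left p0 this).symm
  obtain ⟨u, hu, huF⟩ : ∃ u ∈ φ.ker ⊓ ψ.ker, u ∉ F := by
    apply exists_of_card_lt
    have := card_inf_le φ.ker ψ.ker p p
      (by rw [← cM]; exact card_ker_le φ _ (fun g => ⟨_, s.pw g, rfl⟩))
      (by rw [← cM]; exact card_ker_le ψ _ (fun g => ⟨_, hgc g, rfl⟩))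
    rw [s.cP] at this
    have h4 : p ^ 4 ≤ Nat.card (φ.ker ⊓ ψ.ker : Subgroup P) := by
      refine Nat.le_of_mul_le_mul_left (c := p * p) ?_ (by positivity)
      calc _ = p ^ 6 := by ring
        _ ≤ _ := this
    rw [s.cF]
    exact lt_of_lt_of_le (Nat.pow_lt_pow_right p1 (by norm_num)) h4
  obtain ⟨hu1, hu2⟩ := Subgroup.mem_inf.1 hu
  have hu1' : u ^ p ∈ Y := (QuotientGroup.eq_one_iff _).1 hu1
  have hu2' : ⁅u, ⁅x, y⁆⁆ ∈ Y := (QuotientGroup.eq_one_iff _).1 hu2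
  have up := hY1 _ hu1' (s.αp h u)
  have uc := commutatorElement_eq_one_iff_commute.1 (hY1 _ hu2' (s.αc u))
  have Fu : ∀ f ∈ F, Commute f u := by
    intro f hf
    obtain ⟨w, hw, i, rfl⟩ := s.gen f hf
    exact (cen_comm (s.Nc hw) u).mul_left (uc.symm.zpow_left i)
  obtain ⟨B, hB, FB, uB, -⟩ := EA_ext s.Fea Fu up
  refine h.R4 hB ?_
  have := card_lt h.hp h.pg FB uB huF
  rw [s.cF] at this
  calc p ^ 4 = p * p ^ 3 := by ring
    _ ≤ _ := this

universe u
lemma Lmain (n : ℕ) : ∀ {P : Type u} [Group P] {α : P →* P} {F : Subgroup P},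
    GP p q k P α F → Nat.card P = p ^ (n + 6) → False := by
  induction n with
  | zero => intro P _ α F h hc; exact L6 h hc
  | succ n ih =>
    intro P _ α F h hc
    have := h.fin
    have p1 := h.hp.one_lt
    have cF : Nat.card F = p ^ (n + 4) := h.card_F hc
    obtain ⟨Y, YF, Yc, cY, Yα⟩ := h.red (by
      rintro rfl
      rw [Subgroup.card_bot] at cF
      have : 1 < p ^ (n + 4) := Nat.one_lt_pow (by norm_num) p1
      omega)
    have := normal_of_center Yc
    exact ih (h.quot Y Yα YF) (card_quot h.hp.pos (m := n + 6) hc cY)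

end MP

namespace MP
open scoped commutatorElement

section trans
variable {p : ℕ} {G : Type*} [Group G]

lemma dG_spec [Finite G] : ∃ S : Finset G, S.card = dG G ∧ Subgroup.closure (S : Set G) = ⊤ := by
  have : dG G ∈ {n | ∃ S : Finset G, S.card = n ∧ Subgroup.closure (S : Set G) = ⊤} := by
    apply Nat.sInf_mem
    have := Fintype.ofFinite G
    exact ⟨_, Finset.univ, rfl, by simp⟩
  exact this

lemma normal_of_comm {K : Subgroup G} (h : ∀ a b : G, ⁅a, b⁆ ∈ K) : K.Normal := by
  constructor
  intro n hn g
  have : g * n * g⁻¹ = ⁅g, n⁆ * n := by rw [commutatorElement_def]; group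
  rw [this]; exact K.mul_mem (h _ _) hn

lemma card_le_dG [Finite G] (hp : p.Prime) {K : Subgroup G} (h : ∀ a b : G, ⁅a, b⁆ ∈ K)
    (h2 : ∀ a : G, a ^ p ∈ K) : Nat.card G ≤ p ^ dG G * Nat.card K := by
  classical
  have := normal_of_comm h
  obtain ⟨S, hS, hS2⟩ := dG_spec (G := G)
  let _ : CommGroup (G ⧸ K) := { (inferInstance : Group (G ⧸ K)) with
    mul_comm := by
      intro a b
      induction a using QuotientGroup.induction_on with | H a =>
      induction b using QuotientGroup.induction_on with | H b =>
      rw [← commutatorElement_eq_one_iff_mul_comm]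
      exact (QuotientGroup.eq_one_iff _).2 (h a b) }
  have h3 := card_dvd_exponent_pow_rank' (G ⧸ K) (n := p) (by
    intro g
    induction g using QuotientGroup.induction_on with | H g =>
    exact (QuotientGroup.eq_one_iff _).2 (h2 g))
  have h4 : Group.rank (G ⧸ K) ≤ dG G := by
    rw [← hS]
    refine le_trans (Group.rank_le (S := S.image (QuotientGroup.mk' K)) ?_) Finset.card_image_le
    rw [Finset.coe_image, ← MonoidHom.map_closure, hS2, ← MonoidHom.range_eq_map]
    exact MonoidHom.range_eq_top.2 (QuotientGroup.mk'_surjective K)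
  have h5 := Nat.le_of_dvd (pow_pos hp.pos _) h3
  rw [← K.card_mul_index, mul_comm]
  exact Nat.mul_le_mul_right _ (h5.trans (Nat.pow_le_pow_right hp.pos h4))

lemma coatom_props [Finite G] (hp : p.Prime) (hG : IsPGroup p G) {X : Subgroup G}
    (hX : IsCoatom X) : (∀ a b : G, ⁅a, b⁆ ∈ X) ∧ ∀ a : G, a ^ p ∈ X := by
  have hF : Fact p.Prime := ⟨hp⟩
  have := hG.isNilpotent
  have := Subgroup.NormalizerCondition.normal_of_coatom X Group.normalizerCondition_of_isNilpotent hX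
  have hd : p ∣ Nat.card (G ⧸ X) := by
    rcases (hG.to_quotient X).card_eq_or_dvd with h1 | h1
    · exact absurd (Subgroup.index_eq_one.1 h1) hX.1
    · exact h1
  obtain ⟨u, hu⟩ := exists_prime_orderOf_dvd_card' p hd
  have ht : (Subgroup.zpowers u).comap (QuotientGroup.mk' X) = ⊤ := by
    apply hX.2
    refine lt_of_le_of_ne ?_ ?_
    · intro g hg
      rw [Subgroup.mem_comap]
      have : QuotientGroup.mk' X g = 1 := (QuotientGroup.eq_one_iff g).2 hg
      rw [this]; exact Subgroup.one_mem _
    · intro h0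
      obtain ⟨v, rfl⟩ := QuotientGroup.mk'_surjective X u
      have : v ∈ X := by rw [h0]; exact Subgroup.mem_zpowers _
      have h1 : QuotientGroup.mk' X v = 1 := (QuotientGroup.eq_one_iff v).2 this
      rw [h1, orderOf_one] at hu
      exact hp.one_lt.ne hu
  have key : ∀ g : G, ∃ i : ℤ, u ^ i = (g : G ⧸ X) := by
    intro g
    have : g ∈ (Subgroup.zpowers u).comap (QuotientGroup.mk' X) := by rw [ht]; trivial
    exact this
  have up : u ^ p = 1 := by rw [← hu, pow_orderOf_eq_one]
  constructor
  · intro a b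
    rw [← QuotientGroup.eq_one_iff]
    obtain ⟨i, hi⟩ := key a
    obtain ⟨j, hj⟩ := key b
    have : ((⁅a, b⁆ : G) : G ⧸ X) = ⁅(a : G ⧸ X), (b : G ⧸ X)⁆ := rfl
    rw [this, ← hi, ← hj, commutatorElement_eq_one_iff_commute]
    exact ((Commute.refl u).zpow_left i).zpow_right j
  · intro a
    rw [← QuotientGroup.eq_one_iff, QuotientGroup.mk_pow]
    obtain ⟨i, hi⟩ := key a
    rw [← hi, ← zpow_natCast, ← zpow_mul, mul_comm, zpow_mul, zpow_natCast, up, one_zpow]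

lemma mem_frattini {g : G} : g ∈ frattini G ↔ ∀ X : Subgroup G, IsCoatom X → g ∈ X := by
  simp [frattini, Order.radical, Subgroup.mem_iInf]

lemma dG_le_of_frattini [Finite G] (hp : p.Prime) (hG : IsPGroup p G) :
    p ^ dG G * Nat.card (frattini G) ≤ Nat.card G := by
  classical
  have hF : Fact p.Prime := ⟨hp⟩
  have hcm : ∀ a b : G, ⁅a, b⁆ ∈ frattini G := fun a b =>
    mem_frattini.2 fun X hX => (coatom_props hp hG hX).1 a b
  have hpw : ∀ a : G, a ^ p ∈ frattini G := fun a =>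
    mem_frattini.2 fun X hX => (coatom_props hp hG hX).2 a
  let _ : CommGroup (G ⧸ frattini G) := { (inferInstance : Group (G ⧸ frattini G)) with
    mul_comm := by
      intro a b
      induction a using QuotientGroup.induction_on with | H a =>
      induction b using QuotientGroup.induction_on with | H b =>
      rw [← commutatorElement_eq_one_iff_mul_comm]
      exact (QuotientGroup.eq_one_iff _).2 (hcm a b) }
  have hV : ∀ v : Additive (G ⧸ frattini G), p • v = 0 := by
    intro v
    induction v using Additive.rec with | _ v =>
    induction v using QuotientGroup.induction_on with | H g =>
    exact (QuotientGroup.eq_one_iff _).2 (hpw g)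
  let _ : Module (ZMod p) (Additive (G ⧸ frattini G)) := AddCommGroup.zmodModule (n := p) hV
  have : Module.Finite (ZMod p) (Additive (G ⧸ frattini G)) := Module.Finite.of_finite
  let b := Module.finBasis (ZMod p) (Additive (G ⧸ frattini G))
  have hcard : Nat.card (G ⧸ frattini G) = p ^ Module.finrank (ZMod p) (Additive (G ⧸ frattini G)) := by
    have := Module.natCard_eq_pow_finrank (K := ZMod p) (V := Additive (G ⧸ frattini G))
    rw [Nat.card_zmod] at this
    exact this
  choose t ht using fun i => QuotientGroup.mk'_surjective (frattini G) (b i).toMul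
  have hgen : Subgroup.closure ((Finset.univ.image t : Finset G) : Set G) = ⊤ := by
    apply frattini_nongenerating
    rw [eq_top_iff]
    intro g _
    set C := Subgroup.closure ((Finset.univ.image t : Finset G) : Set G) with hC
    have h1 : ∀ v ∈ Submodule.span (ZMod p) (Set.range b),
        v.toMul ∈ C.map (QuotientGroup.mk' (frattini G)) := by
      intro v hv
      induction hv using Submodule.span_induction with
      | mem v hv =>
        obtain ⟨i, rfl⟩ := hv
        exact ⟨t i, Subgroup.subset_closure (by simp), ht i⟩
      | zero => exact Subgroup.one_mem _
      | add v w _ _ hv hw => exact Subgroup.mul_mem _ hv hw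
      | smul a v _ hv =>
        have : a • v = a.val • v := by
          rw [← Nat.cast_smul_eq_nsmul (ZMod p), ZMod.natCast_zmod_val]
        rw [this]
        exact Subgroup.pow_mem _ hv _
    have h2 : g ∈ (C.map (QuotientGroup.mk' (frattini G))).comap (QuotientGroup.mk' (frattini G)) :=
      h1 (Additive.ofMul (g : G ⧸ frattini G)) (by rw [b.span_eq]; trivial)
    rwa [Subgroup.comap_map_eq, QuotientGroup.ker_mk'] at h2
  have hd : dG G ≤ Module.finrank (ZMod p) (Additive (G ⧸ frattini G)) := by
    refine le_trans (Nat.sInf_le ⟨_, rfl, hgen⟩) (Finset.card_image_le.trans ?_)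
    simp
  rw [← (frattini G).card_mul_index, mul_comm]
  refine Nat.mul_le_mul_left _ ?_
  change _ ≤ Nat.card (G ⧸ frattini G)
  rw [hcard]
  exact Nat.pow_le_pow_right hp.pos hd

end trans

lemma toGP {p q : ℕ} {P : Type*} [Group P] {α : P ≃* P} (h : IsMaximalPair p q 3 P α)
    (h3 : 3 < p) : ∃ k : ℤ, GP p q k P α.toMonoidHom (frattini P) := by
  obtain ⟨hp, hq, fin, pg, ho, hqp, hd, hR, ⟨k, hk, sc⟩, hM⟩ := h
  have hcm : ∀ a b : P, ⁅a, b⁆ ∈ frattini P := fun a b =>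
    mem_frattini.2 fun X hX => (coatom_props hp pg hX).1 a b
  have hpw : ∀ a : P, a ^ p ∈ frattini P := fun a =>
    mem_frattini.2 fun X hX => (coatom_props hp pg hX).2 a
  have csub : ∀ H K : Subgroup P, K ≤ H → Nat.card (K.subgroupOf H) = Nat.card K := fun H K h =>
    Nat.card_congr (Subgroup.subgroupOfEquivOfLe h).toEquiv
  have R1 : ∀ H K : Subgroup P, K ≤ H → (∀ a ∈ H, ∀ b ∈ H, ⁅a, b⁆ ∈ K) → (∀ a ∈ H, a ^ p ∈ K) →
      Nat.card H ≤ p ^ dG H * Nat.card K := by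
    intro H K hKH h1 h2
    have := card_le_dG hp (G := H) (K := K.subgroupOf H) (fun a b => h1 a a.2 b b.2)
      (fun a => h2 a a.2)
    rwa [csub H K hKH] at this
  have R : ∀ H K : Subgroup P, K ≤ H → (∀ a ∈ H, ∀ b ∈ H, ⁅a, b⁆ ∈ K) → (∀ a ∈ H, a ^ p ∈ K) →
      Nat.card H ≤ p ^ 3 * Nat.card K := by
    intro H K hKH h1 h2
    exact (R1 H K hKH h1 h2).trans
      (Nat.mul_le_mul_right _ (Nat.pow_le_pow_right hp.pos (hR H)))
  refine ⟨k, hp, h3, hq, hqp, fin, pg, ?_, hk, ?_, hcm, hpw, ?_, sc, R, ?_⟩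
  · intro x
    have h1 : α ^ q = 1 := by rw [← ho, pow_orderOf_eq_one]
    have h2 : ∀ n : ℕ, ∀ x : P, α.toMonoidHom^[n] x = (α ^ n : MulAut P) x := by
      intro n
      induction n with
      | zero => intro x; rfl
      | succ n ih => intro x; rw [Function.iterate_succ_apply, ih, pow_succ]; rfl
    rw [h2]
    have h4 : (α ^ q : MulAut P) = 1 := h1
    rw [h4]; rfl
  · intro x hx
    have := Subgroup.characteristic_iff_le_comap.1 (frattini_characteristic (G := P)) α
    exact this hx
  · apply le_antisymm
    · have := card_le_dG hp hcm hpw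
      rwa [hd] at this
    · have := dG_le_of_frattini hp pg
      rwa [hd] at this
  · intro H K hH hHα hKH h1 h2 hc hs
    have hdH : dG H = 3 := by
      apply le_antisymm (hR H)
      have h5 := hc.trans (R1 H K hKH h1 h2)
      have h6 : p ^ 3 ≤ p ^ dG H := Nat.le_of_mul_le_mul_right h5 (Nat.card_pos (α := K))
      exact (Nat.pow_le_pow_iff_right hp.one_lt).1 h6
    rcases hM H hH hdH with h5 | h5
    · apply h5
      apply Subgroup.eq_of_le_of_card_ge
      · rintro _ ⟨x, hx, rfl⟩; exact hHα x hx
      · rw [Subgroup.card_map_of_injective α.injective]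
    · apply h5
      refine ⟨k, hk, fun x => ?_⟩
      have hu := hs x x.2
      refine ⟨⟨_, hKH hu⟩, ?_, rfl⟩
      rw [SetLike.mem_coe, mem_frattini]
      intro X hX
      by_contra hne
      obtain ⟨c1, c2⟩ := coatom_props hp (pg.to_subgroup H) hX
      have hXH : X.map H.subtype ≤ H := Subgroup.map_subtype_le X
      have h7 := R H (K ⊓ X.map H.subtype) (inf_le_left.trans hKH)
        (fun a ha b hb => ⟨h1 a ha b hb, ⟨_, c1 ⟨a, ha⟩ ⟨b, hb⟩, rfl⟩⟩)
        (fun a ha => ⟨h2 a ha, ⟨_, c2 ⟨a, ha⟩, rfl⟩⟩)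
      have h8 := card_lt hp pg (A := K ⊓ X.map H.subtype) (B := K) inf_le_left hu (by
        rintro ⟨-, ⟨y, hy, e⟩⟩
        apply hne
        have : y = ⟨_, hKH hu⟩ := Subtype.ext e
        rw [← this]; exact hy)
      have h9 : 0 < Nat.card (K ⊓ X.map H.subtype : Subgroup P) := Nat.card_pos
      have h10 : p ^ 3 * (p * Nat.card (K ⊓ X.map H.subtype : Subgroup P)) ≤
          p ^ 3 * Nat.card (K ⊓ X.map H.subtype : Subgroup P) :=
        (Nat.mul_le_mul_left _ h8).trans (hc.trans h7)
      have h11 := Nat.le_of_mul_le_mul_left h10 (pow_pos hp.pos 3)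
      have := hp.one_lt
      nlinarith

end MP

/-- If `(P, α)` is a maximal `(p,q)`-pair of rank `3` with `p > 3`, then `|P| ≤ p^5`. -/
theorem stmt19 (p q : ℕ) (P : Type*) [Group P] (α : P ≃* P)
    (h : IsMaximalPair p q 3 P α) (hp : 3 < p) :
    Nat.card P ≤ p ^ 5 := by
  obtain ⟨k, g⟩ := MP.toGP h hp
  have := g.fin
  have hF : Fact p.Prime := ⟨g.hp⟩
  obtain ⟨n, hn⟩ := IsPGroup.iff_card.1 g.pg
  rw [hn]
  apply Nat.pow_le_pow_right g.hp.pos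
  by_contra hc
  obtain ⟨m, rfl⟩ : ∃ m, n = m + 6 := ⟨n - 6, by omega⟩
  exact MP.Lmain m g hn
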